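/- arXiv:1004.2482 — 8 statements merged into one kernel-verified Lean document; each statement's English description precedes it below -/
import Mathlib

section
/- Let R ≥ 1 be an integer, let G be a connected graph on n vertices, and suppose S is a nonempty vertex set of G with |S| < n/2 and |∂S| ≤ p·|S| for some real 0 < p < 1. Let U₁, …, U_k be the vertex sets of the connected components of the graph obtained from G by deleting ∂S. Then each |U_i| ≤ n - |S|, and the speed-R cop number satisfies c_R(G) ≤ p·|S| + max_i c_R(G[U_i]). -/
/-!
Speed-`R` Cops and Robbers.  Cops are placed first (several may share a
vertex), then the robber chooses a starting vertex; play proceeds in rounds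
with the cops moving first.  Each cop moves to an adjacent vertex or stays
put; the robber may traverse any walk of at most `R` edges from his current
vertex that does not pass through any vertex currently occupied by a cop.
-/

/-- A legal simultaneous move of the cops: each cop stays put or moves to an
adjacent vertex. -/
def CopMove {V : Type*} (G : SimpleGraph V) {c : ℕ} (C C' : Fin c → V) : Prop :=
  ∀ i, C' i = C i ∨ G.Adj (C i) (C' i)

/-- A legal move of a speed-`R` robber from `u` to `v`, with the cops at
positions `C`: a walk of at most `R` edges all of whose vertices after the
starting one avoid the cops. -/
def RobberMoveR {V : Type*} (G : SimpleGraph V) {c : ℕ} (C : Fin c → V) (R : ℕ)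
    (u v : V) : Prop :=
  ∃ k : ℕ, k ≤ R ∧ ∃ f : ℕ → V, f 0 = u ∧ f k = v ∧
    (∀ i, i < k → G.Adj (f i) (f (i + 1))) ∧
    (∀ i, 0 < i → i ≤ k → ∀ j, C j ≠ f i)

/-- `CopsWinR G R c C r`: with cops at positions `C`, a speed-`R` robber at
`r`, and the cops to move, the `c` cops can force a capture. -/
inductive CopsWinR {V : Type*} (G : SimpleGraph V) (R : ℕ) (c : ℕ) :
    (Fin c → V) → V → Prop
  | catch (C C' : Fin c → V) (r : V) (hm : CopMove G C C') (i : Fin c)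
      (hi : C' i = r) : CopsWinR G R c C r
  | step (C C' : Fin c → V) (r : V) (hm : CopMove G C C')
      (h : ∀ r', RobberMoveR G C' R r r' → CopsWinR G R c C' r') : CopsWinR G R c C r

/-- The speed-`R` cop number: the least number of cops having a winning
strategy against a robber of speed `R`. -/
noncomputable def copNumberR {V : Type*} (G : SimpleGraph V) (R : ℕ) : ℕ :=
  sInf {c : ℕ | ∃ C₀ : Fin c → V, ∀ r : V, CopsWinR G R c C₀ r}


/-- The (outer) boundary of a vertex set `S`: the vertices outside `S`
adjacent to some vertex of `S`. -/
def boundary {V : Type*} (G : SimpleGraph V) (S : Set V) : Set V :=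
  {v | v ∉ S ∧ ∃ u ∈ S, G.Adj u v}

theorem CopMove.refl {V : Type*} (G : SimpleGraph V) {c : ℕ} (C : Fin c → V) : CopMove G C C :=
  fun _ => Or.inl rfl

/-- A robber in `U` all of whose exits are occupied by cops only traverses vertices of `U`. -/
theorem RobberMoveR.exists_walk_mem {V : Type*} {G : SimpleGraph V} {U : Set V} {N R : ℕ}
    {D : Fin N → V} (hD : ∀ u ∈ U, ∀ v ∉ U, G.Adj u v → ∃ j, D j = v)
    {r r' : V} (hr : r ∈ U) (h : RobberMoveR G D R r r') :
    ∃ k ≤ R, ∃ f : ℕ → V, f 0 = r ∧ f k = r' ∧ (∀ i, i < k → G.Adj (f i) (f (i + 1))) ∧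
      (∀ i, 0 < i → i ≤ k → ∀ j, D j ≠ f i) ∧ ∀ i, i ≤ k → f i ∈ U := by
  obtain ⟨k, hk, f, h0, h1, hadj, hav⟩ := h
  refine ⟨k, hk, f, h0, h1, hadj, hav, fun i => ?_⟩
  induction i with
  | zero => intro _; rwa [h0]
  | succ i ih =>
    intro hi
    by_contra hout
    obtain ⟨j, hj⟩ := hD _ (ih (by omega)) _ hout (hadj i (by omega))
    exact hav (i + 1) (by omega) hi j hj

theorem RobberMoveR.mem_of_guarded {V : Type*} {G : SimpleGraph V} {U : Set V} {N R : ℕ}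
    {D : Fin N → V} (hD : ∀ u ∈ U, ∀ v ∉ U, G.Adj u v → ∃ j, D j = v)
    {r r' : V} (hr : r ∈ U) (h : RobberMoveR G D R r r') : r' ∈ U := by
  obtain ⟨k, _, f, _, rfl, _, _, hf⟩ := h.exists_walk_mem hD hr
  exact hf k le_rfl

theorem RobberMoveR.induce {V : Type*} {G : SimpleGraph V} {U : Set V} {N R c : ℕ}
    {D : Fin N → V} (hD : ∀ u ∈ U, ∀ v ∉ U, G.Adj u v → ∃ j, D j = v)
    {e : Fin c → Fin N} {E : Fin c → U} (hE : ∀ i, D (e i) = E i)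
    {r r' : U} (h : RobberMoveR G D R r r') : RobberMoveR (G.induce U) E R r r' := by
  obtain ⟨k, hk, f, h0, h1, hadj, hav, hf⟩ := h.exists_walk_mem hD r.2
  refine ⟨k, hk, fun i => ⟨f (min i k), hf _ (min_le_right _ _)⟩, ?_, ?_, fun i hi => ?_,
    fun i hi hik j hj => ?_⟩
  · simp [h0]
  · simp [h1]
  · have := hadj i hi
    simpa [min_eq_left hi.le, min_eq_left (Nat.succ_le_of_lt hi)] using this
  · apply hav i hi hik (e j)
    simp [hE, hj, min_eq_left hik]

theorem CopMove.extend {V : Type*} {G : SimpleGraph V} {N c : ℕ} {e : Fin c → Fin N}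
    (he : Function.Injective e) {D : Fin N → V} {E' : Fin c → V}
    (h : CopMove G (D ∘ e) E') : CopMove G D (Function.extend e E' D) := by
  intro j
  by_cases hj : ∃ i, e i = j
  · obtain ⟨i, rfl⟩ := hj
    rw [he.extend_apply]
    exact h i
  · exact Or.inl (Function.extend_apply' _ _ _ hj)

/-- If the exits of `U` are guarded by cops outside the range of `e`, then the cops in the range
of `e` may follow a winning strategy on `G[U]`. -/
theorem CopsWinR.of_induce {V : Type*} {G : SimpleGraph V} {U : Set V} {N R c : ℕ}
    {e : Fin c → Fin N} (he : Function.Injective e) {E : Fin c → U} {r : U}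
    (hwin : CopsWinR (G.induce U) R c E r) (D : Fin N → V) (hE : ∀ i, D (e i) = E i)
    (hD : ∀ u ∈ U, ∀ v ∉ U, G.Adj u v → ∃ j, (¬ ∃ i, e i = j) ∧ D j = v) :
    CopsWinR G R N D r := by
  have hmove : ∀ {E E' : Fin c → U} {D : Fin N → V}, (∀ i, D (e i) = E i) →
      CopMove (G.induce U) E E' → CopMove G D (Function.extend e (fun i => (E' i : V)) D) := by
    intro E E' D hE hm
    refine CopMove.extend he fun i => ?_
    simpa [hE, Subtype.ext_iff] using hm i
  induction hwin generalizing D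
  next E E' r hm i hi =>
    exact .catch _ _ _ (hmove hE hm) (e i) (by rw [he.extend_apply, hi])
  next E E' r hm _ ih =>
    have hE' : ∀ i, Function.extend e (fun i => (E' i : V)) D (e i) = E' i :=
      fun i => he.extend_apply _ _ i
    have hD' : ∀ u ∈ U, ∀ v ∉ U, G.Adj u v →
        ∃ j, (¬ ∃ i, e i = j) ∧ Function.extend e (fun i => (E' i : V)) D j = v := by
      intro u hu v hv huv
      obtain ⟨j, hj, rfl⟩ := hD u hu v hv huv
      exact ⟨j, hj, Function.extend_apply' _ _ _ hj⟩
    have hguard : ∀ u ∈ U, ∀ v ∉ U, G.Adj u v →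
        ∃ j, Function.extend e (fun i => (E' i : V)) D j = v := fun u hu v hv huv =>
      (hD' u hu v hv huv).imp fun _ => And.right
    refine .step _ _ _ (hmove hE hm) fun r' hr' => ?_
    have hr'U : r' ∈ U := hr'.mem_of_guarded hguard r.2
    exact ih ⟨r', hr'U⟩ (RobberMoveR.induce (r' := ⟨r', hr'U⟩) hguard hE' hr') _ hE' hD'

/-- If the exits of `U` are guarded, the remaining cops may first walk to the initial positions
of a winning strategy on `G[U]`. -/
theorem CopsWinR.of_induce_of_walk {V : Type*} {G : SimpleGraph V} {U : Set V} {N R c : ℕ}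
    {e : Fin c → Fin N} (he : Function.Injective e) {E : Fin c → U}
    (hwin : ∀ r, CopsWinR (G.induce U) R c E r) (k : ℕ) (D : Fin N → V)
    (hE : ∀ i, ∃ w : G.Walk (D (e i)) (E i), w.length ≤ k)
    (hD : ∀ u ∈ U, ∀ v ∉ U, G.Adj u v → ∃ j, (¬ ∃ i, e i = j) ∧ D j = v)
    {r : V} (hr : r ∈ U) : CopsWinR G R N D r := by
  induction k generalizing D r with
  | zero =>
    refine CopsWinR.of_induce he (hwin ⟨r, hr⟩) D (fun i => ?_) hD
    obtain ⟨w, hw⟩ := hE i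
    exact SimpleGraph.Walk.eq_of_length_eq_zero (Nat.le_zero.mp hw)
  | succ k ih =>
    have hstep : ∀ i, ∃ v, (v = D (e i) ∨ G.Adj (D (e i)) v) ∧
        ∃ w : G.Walk v (E i), w.length ≤ k := by
      intro i
      obtain ⟨w, hw⟩ := hE i
      generalize D (e i) = x at w
      cases w with
      | nil => exact ⟨_, Or.inl rfl, .nil, by simp⟩
      | cons h p => exact ⟨_, Or.inr h, p, by simpa using hw⟩
    choose E' hE' hw using hstep
    have hD' : ∀ u ∈ U, ∀ v ∉ U, G.Adj u v →
        ∃ j, (¬ ∃ i, e i = j) ∧ Function.extend e E' D j = v := by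
      intro u hu v hv huv
      obtain ⟨j, hj, rfl⟩ := hD u hu v hv huv
      exact ⟨j, hj, Function.extend_apply' _ _ _ hj⟩
    refine .step _ _ _ (CopMove.extend he hE') fun r' hr' => ih _ (fun i => ?_) hD' ?_
    · rw [he.extend_apply]
      exact hw i
    · exact hr'.mem_of_guarded (fun u hu v hv huv =>
        (hD' u hu v hv huv).imp fun _ => And.right) hr

/-- The infimum defining the cop number of a finite graph is attained. -/
theorem exists_copsWinR_copNumberR {V : Type*} [Finite V] (G : SimpleGraph V) (R : ℕ) :
    ∃ C₀ : Fin (copNumberR G R) → V, ∀ r : V, CopsWinR G R (copNumberR G R) C₀ r := by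
  refine Nat.sInf_mem (s := {c : ℕ | ∃ C₀ : Fin c → V, ∀ r : V, CopsWinR G R c C₀ r})
    ⟨Nat.card V, (Finite.equivFin V).symm, fun r => ?_⟩
  exact .catch _ _ _ (CopMove.refl _ _) (Finite.equivFin V r) (by simp)

theorem mem_boundary_of_adj_component {V : Type*} {G : SimpleGraph V} {B : Set V}
    (comp : (G.induce Bᶜ).ConnectedComponent) {u v : V}
    (hu : u ∈ Subtype.val '' comp.supp) (hv : v ∉ Subtype.val '' comp.supp) (huv : G.Adj u v) :
    v ∈ B := by
  by_contra hvB
  obtain ⟨u, hu, rfl⟩ := hu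
  refine hv ⟨⟨v, hvB⟩, ?_, rfl⟩
  exact comp.mem_supp_of_adj_mem_supp hu (by simpa using huv)

/-- Guarding a vertex set `B` costs `|B|` cops and reduces the game to a component of `G - B`. -/
theorem copNumberR_le_ncard_add {V : Type*} [Finite V] {G : SimpleGraph V} (hG : G.Connected)
    (R : ℕ) (B : Set V) (m : ℕ)
    (hm : ∀ comp : (G.induce Bᶜ).ConnectedComponent,
      copNumberR (G.induce (Subtype.val '' comp.supp)) R ≤ m) :
    copNumberR G R ≤ B.ncard + m := by
  obtain ⟨v₀⟩ := hG.nonempty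
  let g : B ≃ Fin B.ncard := Finite.equivFin B
  let D : Fin (B.ncard + m) → V := Fin.append (fun i => (g.symm i : V)) fun _ => v₀
  have hDB : ∀ v ∈ B, ∃ i, D (Fin.castAdd m i) = v := fun v hv => ⟨g ⟨v, hv⟩, by simp [D]⟩
  refine Nat.sInf_le ⟨D, fun r => ?_⟩
  by_cases hr : r ∈ B
  · obtain ⟨i, hi⟩ := hDB r hr
    exact .catch _ _ _ (CopMove.refl _ _) _ hi
  let comp := (G.induce Bᶜ).connectedComponentMk ⟨r, hr⟩
  obtain ⟨E, hE⟩ := exists_copsWinR_copNumberR (G.induce (Subtype.val '' comp.supp)) R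
  let e : Fin (copNumberR (G.induce (Subtype.val '' comp.supp)) R) → Fin (B.ncard + m) :=
    fun i => Fin.natAdd B.ncard (Fin.castLE (hm comp) i)
  have he : Function.Injective e :=
    (Fin.natAdd_injective _ _).comp (Fin.castLE_injective (hm comp))
  have hwalk : ∀ i, ∃ w : G.Walk (D (e i)) (E i), w.length ≤ Nat.card V := by
    intro i
    obtain ⟨w, hw⟩ := (hG (D (e i)) (E i)).exists_isPath
    have := Fintype.ofFinite V
    exact ⟨w, by rw [Nat.card_eq_fintype_card]; exact hw.length_lt.le⟩
  refine CopsWinR.of_induce_of_walk he hE _ D hwalk (fun u hu v hv huv => ?_)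
    ⟨⟨r, hr⟩, rfl, rfl⟩
  obtain ⟨i, hi⟩ := hDB v (mem_boundary_of_adj_component comp hu hv huv)
  refine ⟨_, ?_, hi⟩
  rintro ⟨j, hj⟩
  have := congrArg Fin.val hj
  simp only [e, Fin.val_natAdd, Fin.val_castAdd] at this
  omega

/-- A component of `G - ∂S` either lies inside `S` or is disjoint from `S`. -/
theorem component_subset_or_disjoint {V : Type*} (G : SimpleGraph V) (S : Set V)
    (comp : (G.induce (boundary G S)ᶜ).ConnectedComponent) :
    Subtype.val '' comp.supp ⊆ S ∨ Subtype.val '' comp.supp ⊆ Sᶜ := by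
  have hadj : ∀ u v : ((boundary G S)ᶜ : Set V), (G.induce (boundary G S)ᶜ).Adj u v →
      u.1 ∈ S → v.1 ∈ S := fun u v huv hu =>
    by_contra fun hv => v.2 ⟨hv, u, hu, huv⟩
  have hwalk : ∀ u v : ((boundary G S)ᶜ : Set V), (G.induce (boundary G S)ᶜ).Walk u v →
      u.1 ∈ S → v.1 ∈ S := by
    intro u v w
    induction w with
    | nil => exact id
    | cons h _ ih => exact fun hu => ih (hadj _ _ h hu)
  by_cases h : ∃ u ∈ comp.supp, u.1 ∈ S
  · obtain ⟨u, hu, huS⟩ := h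
    left
    rintro _ ⟨v, hv, rfl⟩
    obtain ⟨w⟩ := comp.reachable_of_mem_supp hu hv
    exact hwalk u v w huS
  · right
    rintro _ ⟨v, hv, rfl⟩ hvS
    exact h ⟨v, hv, hvS⟩

/-- Lemma 2: if a connected graph `G` on `n` vertices has a nonempty vertex
set `S` with `|S| < n/2` and `|∂S| ≤ p|S|` for some `0 < p < 1`, and
`U₁, …, U_k` are the vertex sets of the connected components of `G - ∂S`,
then every `|U_i| ≤ n - |S|` and `c_R(G) ≤ p|S| + max_i c_R(G[U_i])`, even
for a robber of any speed `R ≥ 1`. -/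
theorem copNumberR_expansion_reduction {V : Type} [Fintype V] (G : SimpleGraph V)
    (n : ℕ) (hn : Fintype.card V = n) (hconn : G.Connected)
    (R : ℕ) (hR : 1 ≤ R) (p : ℝ) (hp0 : 0 < p) (hp1 : p < 1)
    (S : Set V) (hSne : S.Nonempty) (hShalf : (S.ncard : ℝ) < n / 2)
    (hSexp : ((boundary G S).ncard : ℝ) ≤ p * S.ncard) :
    (∀ comp : (G.induce ((boundary G S)ᶜ)).ConnectedComponent,
        (Subtype.val '' comp.supp).ncard ≤ n - S.ncard) ∧
      (copNumberR G R : ℝ) ≤ p * S.ncard + (sSup (Set.range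
        fun comp : (G.induce ((boundary G S)ᶜ)).ConnectedComponent =>
          copNumberR (G.induce (Subtype.val '' comp.supp)) R) : ℕ) := by
  refine ⟨fun comp => ?_, ?_⟩
  · have hcompl : Sᶜ.ncard = n - S.ncard := by
      rw [Set.ncard_compl, Nat.card_eq_fintype_card, hn]
    rcases component_subset_or_disjoint G S comp with h | h
    · refine (Set.ncard_le_ncard h).trans ?_
      have h2 : S.ncard + S.ncard < n := by
        have : (S.ncard : ℝ) + S.ncard < n := by linarith
        exact_mod_cast this
      omega
    · exact hcompl ▸ Set.ncard_le_ncard h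
  · refine le_trans (Nat.cast_le.mpr <| copNumberR_le_ncard_add hconn R (boundary G S) _
      fun comp => le_csSup (Set.finite_range _).bddAbove ⟨comp, rfl⟩) ?_
    push_cast
    gcongr
end

section
/- Let D be a strongly connected digraph on n vertices, let 0 < p < 1, and suppose S is a nonempty vertex set of D with |S| < n/2 and |∂⁻S| ≤ p·|S|. Let U₁, …, U_k be the vertex sets of the strongly connected components of the digraph obtained from D by deleting ∂⁻S. Then each |U_i| ≤ n - |S|, and c(D) ≤ p·|S| + max_i c(D[U_i]). -/
/-!
Cops and Robbers on directed graphs.  A position consists of the cops'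
locations (a function `Fin c → V`, so several cops may share a vertex) and the
robber's location.  In each round the cops move first, each along at most one
directed edge (or staying put); then the robber moves likewise.  `DCopsWin`
holds when the cops (moving first from the current position) can force a
capture in finitely many rounds.
-/

/-- A legal simultaneous move of the cops in a digraph: each cop stays put or
moves along one directed edge. -/
def DCopMove {V : Type*} (D : Digraph V) {c : ℕ} (C C' : Fin c → V) : Prop :=
  ∀ i, C' i = C i ∨ D.Adj (C i) (C' i)

/-- `DCopsWin D c C r`: with cops at positions `C` and the robber at `r`,
and the cops to move, the `c` cops can force a capture. -/
inductive DCopsWin {V : Type*} (D : Digraph V) (c : ℕ) : (Fin c → V) → V → Prop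
  | catch (C C' : Fin c → V) (r : V) (hm : DCopMove D C C') (i : Fin c)
      (hi : C' i = r) : DCopsWin D c C r
  | step (C C' : Fin c → V) (r : V) (hm : DCopMove D C C')
      (h : ∀ r', (r' = r ∨ D.Adj r r') → DCopsWin D c C' r') : DCopsWin D c C r

/-- The cop number of a digraph: the least number of cops having a winning
strategy (first the cops choose starting positions, then the robber, knowing
them, chooses his starting vertex; then play proceeds with the cops moving
first). -/
noncomputable def dCopNumber {V : Type*} (D : Digraph V) : ℕ :=
  sInf {c : ℕ | ∃ C₀ : Fin c → V, ∀ r : V, DCopsWin D c C₀ r}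

/-- A digraph is strongly connected if every vertex can reach every other
vertex by a directed path. -/
def Digraph.StronglyConnected {V : Type*} (D : Digraph V) : Prop :=
  ∀ u v : V, Relation.ReflTransGen D.Adj u v


/-- The in-boundary `∂⁻S` of a vertex set `S`: the vertices outside `S`
having a directed edge into `S`. -/
def inBoundary {V : Type*} (D : Digraph V) (S : Set V) : Set V :=
  {v | v ∉ S ∧ ∃ u ∈ S, D.Adj v u}

/-- The subdigraph of `D` induced on a vertex set `U`. -/
def Digraph.induce {V : Type*} (D : Digraph V) (U : Set V) : Digraph U :=
  ⟨fun a b => D.Adj a b⟩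

/-- Mutual reachability in a digraph. -/
def Digraph.MutualReach {V : Type*} (D : Digraph V) (u v : V) : Prop :=
  Relation.ReflTransGen D.Adj u v ∧ Relation.ReflTransGen D.Adj v u

/-- `U` is (the vertex set of) a strongly connected component of `D`: an
equivalence class of the mutual-reachability relation. -/
def Digraph.IsSCC {V : Type*} (D : Digraph V) (U : Set V) : Prop :=
  ∃ u : V, U = {v | D.MutualReach u v}

theorem DCopMove.refl {V : Type*} (D : Digraph V) {c : ℕ} (C : Fin c → V) : DCopMove D C C :=
  fun _ => Or.inl rfl

theorem DCopsWin.of_occupied {V : Type*} {D : Digraph V} {c : ℕ} {C : Fin c → V} {r : V}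
    (i : Fin c) (hi : C i = r) : DCopsWin D c C r :=
  DCopsWin.catch C C r (DCopMove.refl D C) i hi

theorem exists_dCopsWin_dCopNumber {V : Type*} [Finite V] (D : Digraph V) :
    ∃ C : Fin (dCopNumber D) → V, ∀ r, DCopsWin D (dCopNumber D) C r := by
  refine Nat.sInf_mem (s := {c : ℕ | ∃ C₀ : Fin c → V, ∀ r : V, DCopsWin D c C₀ r})
    ⟨Nat.card V, (Finite.equivFin V).symm, fun r => ?_⟩
  exact .of_occupied (Finite.equivFin V r) (Equiv.symm_apply_apply _ _)

theorem DCopMove.extend {V : Type*} {D : Digraph V} {k m : ℕ} {f : Fin k → Fin m}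
    (hf : Function.Injective f) {C' : Fin k → V} {H : Fin m → V}
    (h : DCopMove D (H ∘ f) C') : DCopMove D H (Function.extend f C' H) := by
  intro j
  by_cases hj : ∃ i, f i = j
  · obtain ⟨i, rfl⟩ := hj
    rw [hf.extend_apply]
    exact h i
  · rw [Function.extend_apply' _ _ _ hj]
    exact Or.inl rfl

/-- Additional cops do not hurt. -/
theorem DCopsWin.of_comp {V : Type*} {D : Digraph V} {k m : ℕ} {f : Fin k → Fin m}
    (hf : Function.Injective f) {C : Fin k → V} {r : V} (h : DCopsWin D k C r) :
    ∀ H : Fin m → V, H ∘ f = C → DCopsWin D m H r := by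
  induction h
  next C C' r hm i hi =>
    rintro H rfl
    exact DCopsWin.catch _ _ _ (hm.extend hf) (f i) (by rw [hf.extend_apply, hi])
  next C C' r hm _ ih =>
    rintro H rfl
    exact .step _ _ _ (hm.extend hf) fun r' hr' =>
      ih r' hr' _ (funext fun i => hf.extend_apply _ _ _)

/-- In a nonempty digraph, any number of cops at least the cop number can win. -/
theorem exists_dCopsWin_of_dCopNumber_le {V : Type*} [Finite V] [Nonempty V] (D : Digraph V)
    {m : ℕ} (hm : dCopNumber D ≤ m) : ∃ C : Fin m → V, ∀ r, DCopsWin D m C r := by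
  obtain ⟨C, hC⟩ := exists_dCopsWin_dCopNumber D
  have hf := Fin.castLE_injective hm
  refine ⟨Function.extend (Fin.castLE hm) C fun _ => Classical.arbitrary V, fun r => ?_⟩
  exact (hC r).of_comp hf _ (funext fun i => hf.extend_apply _ _ _)

/-- In a strongly connected digraph the cops can travel from any configuration to any other. -/
theorem Digraph.StronglyConnected.reflTransGen_dCopMove {V : Type*} {D : Digraph V}
    (hD : D.StronglyConnected) {m : ℕ} (H H' : Fin m → V) :
    Relation.ReflTransGen (DCopMove D) H H' := by
  classical
  have key : ∀ s : Finset (Fin m),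
      Relation.ReflTransGen (DCopMove D) H (s.piecewise H' H) := by
    intro s
    induction s using Finset.induction_on with
    | empty => rw [Finset.piecewise_empty]
    | insert a s _ ih =>
      rw [Finset.piecewise_insert]
      refine ih.trans ?_
      have hl := (hD (s.piecewise H' H a) (H' a)).lift (p := DCopMove D)
        (Function.update (s.piecewise H' H) a) fun x y hxy j => by
          by_cases hj : j = a
          · subst hj
            simp [hxy]
          · simp [hj]
      rwa [Function.onFun, Function.update_eq_self] at hl
  simpa using key Finset.univ

theorem DCopMove.append {V : Type*} {D : Digraph V} {b m : ℕ} (G : Fin b → V)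
    {H H' : Fin m → V} (h : DCopMove D H H') :
    DCopMove D (Fin.append G H) (Fin.append G H') := by
  intro i
  refine Fin.addCases (fun i => ?_) (fun i => ?_) i
  · simp
  · simpa using h i

/-- A position reached while stationary cops `G` guard `B` is winning as soon as a cop move leads
to winning positions for every robber reply that avoids `B`. -/
theorem DCopsWin.append_step {V : Type*} {D : Digraph V} {B : Set V} {b m : ℕ} {G : Fin b → V}
    (hG : B ⊆ Set.range G) {H H' : Fin m → V} {r : V} (hm : DCopMove D H H')
    (h : ∀ r' ∉ B, r' = r ∨ D.Adj r r' → DCopsWin D (b + m) (Fin.append G H') r') :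
    DCopsWin D (b + m) (Fin.append G H) r := by
  refine .step _ _ _ (hm.append G) fun r' hr' => ?_
  by_cases hB : r' ∈ B
  · obtain ⟨i, hi⟩ := hG hB
    exact .of_occupied (Fin.castAdd m i) (by simpa using hi)
  · exact h r' hB hr'

/-- A strategy on the subdigraph induced on `U` can be played in `D` while `B` is guarded, provided
the cops win once the robber leaves `U`. -/
theorem DCopsWin.append_of_induce {V : Type*} {D : Digraph V} {B U : Set V} {b m : ℕ}
    {G : Fin b → V} (hG : B ⊆ Set.range G)
    (hexit : ∀ r ∈ U, ∀ r' ∉ B, D.Adj r r' → r' ∉ U →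
      ∀ H : Fin m → V, DCopsWin D (b + m) (Fin.append G H) r')
    {C : Fin m → U} {r : U} (h : DCopsWin (D.induce U) m C r) :
    DCopsWin D (b + m) (Fin.append G (Subtype.val ∘ C)) r := by
  have lift {C C' : Fin m → U} (hm : DCopMove (D.induce U) C C') :
      DCopMove D (Subtype.val ∘ C) (Subtype.val ∘ C') :=
    fun i => (hm i).imp (congrArg Subtype.val) id
  induction h
  next C C' r hm i hi =>
    exact DCopsWin.catch _ _ _ ((lift hm).append G) (Fin.natAdd b i) (by simp [hi])
  next C C' r hm _ ih =>
    refine .append_step hG (lift hm) fun r' hB hr' => ?_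
    by_cases hU : r' ∈ U
    · exact ih ⟨r', hU⟩ (hr'.imp Subtype.ext id)
    · rcases hr' with rfl | hadj
      · exact absurd r.2 hU
      · exact hexit r r.2 r' hB hadj hU _

/-- Guarding `B` and clearing the strongly connected components of its complement one after the
other wins the game. -/
theorem DCopsWin.append_of_forall_isSCC {V : Type*} [Finite V] {D : Digraph V}
    (hD : D.StronglyConnected) {B : Set V} {b m : ℕ} {G : Fin b → V} (hG : B ⊆ Set.range G)
    (hm : ∀ U : Set (Bᶜ : Set V), (D.induce Bᶜ).IsSCC U →
      dCopNumber (D.induce (Subtype.val '' U)) ≤ m)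
    (H : Fin m → V) (r : V) : DCopsWin D (b + m) (Fin.append G H) r := by
  by_cases hr : r ∈ B
  · obtain ⟨i, hi⟩ := hG hr
    exact .of_occupied (Fin.castAdd m i) (by simpa using hi)
  let R : (Bᶜ : Set V) → (Bᶜ : Set V) → Prop := Relation.ReflTransGen (D.induce Bᶜ).Adj
  let lt : (Bᶜ : Set V) → (Bᶜ : Set V) → Prop := fun x y => R y x ∧ ¬ R x y
  have : IsTrans _ lt := ⟨fun x y z hxy hyz =>
    ⟨hyz.1.trans hxy.1, fun hxz => hxy.2 (hxz.trans hyz.1)⟩⟩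
  have : Std.Irrefl lt := ⟨fun x hx => hx.2 hx.1⟩
  suffices key : ∀ (x : (Bᶜ : Set V)) (H : Fin m → V),
      DCopsWin D (b + m) (Fin.append G H) x from key ⟨r, hr⟩ H
  intro x
  induction x using (Finite.wellFounded_of_trans_of_irrefl lt).induction with
  | _ x ih =>
  intro H
  let U : Set (Bᶜ : Set V) := {v | (D.induce Bᶜ).MutualReach x v}
  have hxU : x ∈ U := ⟨.refl, .refl⟩
  have hexit : ∀ y ∈ Subtype.val '' U, ∀ y' ∉ B, D.Adj y y' → y' ∉ Subtype.val '' U →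
      ∀ H : Fin m → V, DCopsWin D (b + m) (Fin.append G H) y' := by
    rintro _ ⟨y, hy, rfl⟩ y' hB hadj hU
    have hreach : R x ⟨y', hB⟩ := hy.1.tail hadj
    exact ih ⟨y', hB⟩ ⟨hreach, fun hback => hU ⟨⟨y', hB⟩, ⟨hreach, hback⟩, rfl⟩⟩
  have : Nonempty (Subtype.val '' U) := ⟨⟨x, x, hxU, rfl⟩⟩
  obtain ⟨C, hC⟩ := exists_dCopsWin_of_dCopNumber_le _ (hm U ⟨x, rfl⟩)
  suffices travel : ∀ y ∈ Subtype.val '' U, DCopsWin D (b + m) (Fin.append G H) y from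
    travel x ⟨x, hxU, rfl⟩
  induction hD.reflTransGen_dCopMove H (Subtype.val ∘ C) using
    Relation.ReflTransGen.head_induction_on with
  | refl => exact fun y hy => (hC ⟨y, hy⟩).append_of_induce hG hexit
  | head hstep _ ih' =>
    refine fun y hy => .append_step hG hstep fun y' hB hy' => ?_
    by_cases hU : y' ∈ Subtype.val '' U
    · exact ih' y' hU
    · rcases hy' with rfl | hadj
      · exact absurd hy hU
      · exact hexit y hy y' hB hadj hU _

theorem dCopNumber_le_ncard_add {V : Type*} [Finite V] [Nonempty V] {D : Digraph V}
    (hD : D.StronglyConnected) (B : Set V) {m : ℕ}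
    (hm : ∀ U : Set (Bᶜ : Set V), (D.induce Bᶜ).IsSCC U →
      dCopNumber (D.induce (Subtype.val '' U)) ≤ m) :
    dCopNumber D ≤ B.ncard + m := by
  let e : B ≃ Fin B.ncard := Finite.equivFinOfCardEq (Nat.card_coe_set_eq B)
  have hG : B ⊆ Set.range (Subtype.val ∘ e.symm) := fun v hv => ⟨e ⟨v, hv⟩, by simp⟩
  exact Nat.sInf_le ⟨_, fun r =>
    DCopsWin.append_of_forall_isSCC hD hG hm (fun _ => Classical.arbitrary V) r⟩

/-- Once `∂⁻S` is deleted, a vertex that reaches `S` lies in `S`. -/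
theorem mem_of_reflTransGen_induce_compl_inBoundary {V : Type*} {D : Digraph V} {S : Set V}
    {u v : ((inBoundary D S)ᶜ : Set V)}
    (h : Relation.ReflTransGen (D.induce (inBoundary D S)ᶜ).Adj u v) (hv : (v : V) ∈ S) :
    (u : V) ∈ S := by
  induction h using Relation.ReflTransGen.head_induction_on with
  | refl => exact hv
  | @head a c hac _ ih => exact by_contra fun ha => a.2 ⟨ha, c, ih, hac⟩

theorem Digraph.IsSCC.image_subset_or_subset_compl {V : Type*} {D : Digraph V} {S : Set V}
    {U : Set ((inBoundary D S)ᶜ : Set V)} (hU : (D.induce (inBoundary D S)ᶜ).IsSCC U) :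
    Subtype.val '' U ⊆ S ∨ Subtype.val '' U ⊆ Sᶜ := by
  obtain ⟨u, rfl⟩ := hU
  by_cases hu : (u : V) ∈ S
  · left
    rintro _ ⟨v, hv, rfl⟩
    exact mem_of_reflTransGen_induce_compl_inBoundary hv.2 hu
  · right
    rintro _ ⟨v, hv, rfl⟩ hvS
    exact hu (mem_of_reflTransGen_induce_compl_inBoundary hv.1 hvS)

/-- Lemma 4(ii): if a strongly connected digraph `D` on `n` vertices has a
nonempty vertex set `S` with `|S| < n/2` and `|∂⁻S| ≤ p|S|` for some
`0 < p < 1`, and `U₁, …, U_k` are the vertex sets of the strongly connected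
components of `D - ∂⁻S`, then every `|U_i| ≤ n - |S|` and
`c(D) ≤ p|S| + max_i c(D[U_i])`. -/
theorem dCopNumber_expansion_reduction {V : Type} [Fintype V] (D : Digraph V)
    (n : ℕ) (hn : Fintype.card V = n) (hconn : D.StronglyConnected)
    (p : ℝ) (hp0 : 0 < p) (hp1 : p < 1)
    (S : Set V) (hSne : S.Nonempty) (hShalf : (S.ncard : ℝ) < n / 2)
    (hSexp : ((inBoundary D S).ncard : ℝ) ≤ p * S.ncard) :
    (∀ U : Set ((inBoundary D S)ᶜ : Set V),
        (D.induce ((inBoundary D S)ᶜ)).IsSCC U →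
          (Subtype.val '' U).ncard ≤ n - S.ncard) ∧
      (dCopNumber D : ℝ) ≤ p * S.ncard + (sSup {m : ℕ |
        ∃ U : Set ((inBoundary D S)ᶜ : Set V),
          (D.induce ((inBoundary D S)ᶜ)).IsSCC U ∧
            m = dCopNumber (D.induce (Subtype.val '' U))} : ℕ) := by
  refine ⟨fun U hU => ?_, ?_⟩
  · rcases hU.image_subset_or_subset_compl with h | h
    · have h1 := Set.ncard_le_ncard h
      have h2 : 2 * S.ncard < n := by
        have : (2 * S.ncard : ℝ) < n := by linarith
        exact_mod_cast this
      omega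
    · rw [← hn, ← Nat.card_eq_fintype_card, ← Set.ncard_compl]
      exact Set.ncard_le_ncard h
  · have : Nonempty V := ⟨hSne.some⟩
    refine le_trans ?_ (add_le_add_left hSexp _)
    norm_cast
    refine dCopNumber_le_ncard_add hconn _ fun U hU => le_csSup ?_ ⟨U, hU, rfl⟩
    refine (Set.Finite.subset (Set.finite_range fun U : Set ((inBoundary D S)ᶜ : Set V) =>
      dCopNumber (D.induce (Subtype.val '' U))) ?_).bddAbove
    rintro _ ⟨U, -, rfl⟩
    exact ⟨U, rfl⟩
end

section
/- Let D be a strongly connected digraph on n vertices and let 0 < p < 1. Then there exists an induced subdigraph D' of D on m ≤ n vertices which is strongly connected, has maximum out-degree at most 1/p, is a p-in-expander, and satisfies c(D) ≤ p·n + c(D'). -/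
/-- A digraph on a vertex type `W` is a `p`-in-expander if every vertex
set `S` of size at most half the number of vertices satisfies
`|∂⁻S| ≥ p|S|`. -/
def Digraph.IsInExpander {W : Type*} (D : Digraph W) (p : ℝ) : Prop :=
  ∀ S : Set W, (S.ncard : ℝ) ≤ Nat.card W / 2 →
    p * S.ncard ≤ ((inBoundary D S).ncard : ℝ)

open Relation

namespace CopsAndRobbers

variable {V : Type*}

theorem DCopMove.refl (G : Digraph V) {c : ℕ} (C : Fin c → V) : DCopMove G C C :=
  fun _ => Or.inl rfl

theorem DCopMove.append {G : Digraph V} {k m : ℕ} {b b' : Fin k → V} {C C' : Fin m → V}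
    (hb : DCopMove G b b') (h : DCopMove G C C') :
    DCopMove G (Fin.append b C) (Fin.append b' C') := by
  intro i
  induction i using Fin.addCases with
  | left i => simpa using hb i
  | right i => simpa using h i

/-- On a finite digraph, `dCopNumber` many cops do have a winning strategy. -/
theorem exists_win_dCopNumber [Finite V] (G : Digraph V) :
    ∃ C₀ : Fin (dCopNumber G) → V, ∀ r : V, DCopsWin G (dCopNumber G) C₀ r := by
  have hne : {c : ℕ | ∃ C₀ : Fin c → V, ∀ r : V, DCopsWin G c C₀ r}.Nonempty := by
    refine ⟨Nat.card V, (Finite.equivFin V).symm, fun r => ?_⟩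
    exact .catch _ _ r (DCopMove.refl G _) (Finite.equivFin V r) (by simp)
  exact Nat.sInf_mem hne

theorem DCopsWin.map {W : Type*} {G : Digraph V} {H : Digraph W} (e : G.Adj ≃r H.Adj)
    {c : ℕ} {C : Fin c → V} {r : V} (h : DCopsWin G c C r) :
    DCopsWin H c (e ∘ C) (e r) := by
  have hmove : ∀ {C C' : Fin c → V}, DCopMove G C C' → DCopMove H (e ∘ C) (e ∘ C') :=
    fun hm i => (hm i).imp (congrArg e) e.map_rel_iff.2
  induction h with
  | step C C' r hm _ ih =>
    refine .step _ (e ∘ C') _ (hmove hm) fun r' hr' => ?_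
    obtain ⟨s, rfl⟩ := e.surjective r'
    exact ih s (hr'.imp (fun h => e.injective h) e.map_rel_iff.1)
  | _ C C' r hm i hi => exact .catch _ (e ∘ C') _ (hmove hm) i (congrArg e hi)

theorem dCopNumber_le_of_relIso {W : Type*} [Finite V] {G : Digraph V} {H : Digraph W}
    (e : G.Adj ≃r H.Adj) : dCopNumber H ≤ dCopNumber G := by
  obtain ⟨C₀, h⟩ := exists_win_dCopNumber G
  refine Nat.sInf_le ⟨e ∘ C₀, fun r => ?_⟩
  simpa using DCopsWin.map e (h (e.symm r))

theorem stronglyConnected_of_relIso {W : Type*} {G : Digraph V} {H : Digraph W}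
    (e : G.Adj ≃r H.Adj) (h : G.StronglyConnected) : H.StronglyConnected := by
  intro u v
  have := (h (e.symm u) (e.symm v)).lift e fun _ _ => e.map_rel_iff.2
  simpa [Function.onFun] using this

/-- Inducing twice is the same as inducing once on the image. -/
noncomputable def induceInduceRelIso (D : Digraph V) (U : Set V) (T : Set U) :
    ((D.induce U).induce T).Adj ≃r (D.induce (Subtype.val '' T)).Adj where
  toEquiv := Equiv.Set.image Subtype.val T Subtype.val_injective
  map_rel_iff' := Iff.rfl

/-- In a strongly connected digraph any cop configuration can be brought to any other. -/
theorem reflTransGen_dCopMove {G : Digraph V} (hG : G.StronglyConnected) {m : ℕ}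
    (C C' : Fin m → V) : ReflTransGen (DCopMove G) C C' := by
  classical
  have one (C : Fin m → V) (j : Fin m) (t : V) :
      ReflTransGen (DCopMove G) C (Function.update C j t) := by
    have h := hG (C j) t
    induction h with
    | refl => rw [Function.update_eq_self]
    | tail _ hab ih =>
      refine ih.tail fun i => ?_
      rcases eq_or_ne i j with rfl | hij
      · simpa using Or.inr hab
      · simp [hij]
  have all (s : Finset (Fin m)) : ReflTransGen (DCopMove G) C (s.piecewise C' C) := by
    induction s using Finset.induction_on with
    | empty => simpa using ReflTransGen.refl
    | insert j s _ ih =>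
      rw [Finset.piecewise_insert]
      exact ih.trans (one _ _ _)
  simpa using all Finset.univ

section Guards

variable {G : Digraph V} {k m : ℕ} {b : Fin k → V} {T : Set V}

theorem win_of_guarded {r : V} {i : Fin k} (h : r = b i ∨ G.Adj (b i) r) (C : Fin m → V) :
    DCopsWin G (k + m) (Fin.append b C) r := by
  classical
  refine .catch _ (Fin.append (Function.update b i r) C) r
    (DCopMove.append (fun j => ?_) (DCopMove.refl G C)) (Fin.castAdd m i) (by simp)
  rcases eq_or_ne j i with rfl | hj
  · simpa using h
  · simp [hj]

/-- While the guards stand on `b`, the free cops may rearrange themselves, as long as they win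
whenever the robber leaves `T`. -/
theorem win_of_reflTransGen
    (hout : ∀ x ∈ T, ∀ y ∉ T, G.Adj x y → ∀ C : Fin m → V,
      DCopsWin G (k + m) (Fin.append b C) y)
    {C C' : Fin m → V} (h : ReflTransGen (DCopMove G) C C')
    (hwin : ∀ r ∈ T, DCopsWin G (k + m) (Fin.append b C') r) :
    ∀ r ∈ T, DCopsWin G (k + m) (Fin.append b C) r := by
  induction h using ReflTransGen.head_induction_on with
  | refl => exact hwin
  | head hm _ ih =>
    refine fun r hr => .step _ _ r (DCopMove.append (DCopMove.refl G b) hm) fun r' hr' => ?_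
    by_cases hT : r' ∈ T
    · exact ih r' hT
    · exact hout r hr r' hT (hr'.resolve_left fun h => hT (h ▸ hr)) _

/-- A winning strategy inside `T` lifts to the whole digraph, as long as the cops win whenever
the robber leaves `T`. -/
theorem win_of_induce
    (hout : ∀ x ∈ T, ∀ y ∉ T, G.Adj x y → ∀ C : Fin m → V,
      DCopsWin G (k + m) (Fin.append b C) y)
    {c : ℕ} (hc : c ≤ m) {CT : Fin c → T} {r : T} (h : DCopsWin (G.induce T) c CT r)
    (C : Fin m → V) (hC : ∀ i, C (Fin.castLE hc i) = CT i) :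
    DCopsWin G (k + m) (Fin.append b C) r := by
  have key (C : Fin m → V) (CT CT' : Fin c → T) (hm : DCopMove (G.induce T) CT CT')
      (hC : ∀ i, C (Fin.castLE hc i) = CT i) : ∃ C' : Fin m → V, DCopMove G C C' ∧
        ∀ i, C' (Fin.castLE hc i) = CT' i := by
    refine ⟨fun j => if hj : j.1 < c then CT' ⟨j, hj⟩ else C j, fun j => ?_, fun i => ?_⟩
    · by_cases hj : j.1 < c
      · have := hC ⟨j, hj⟩
        simp only [hj, dite_true]
        rw [show C j = CT ⟨j, hj⟩ from this]
        exact (hm ⟨j, hj⟩).imp (congrArg Subtype.val) id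
      · simp [hj]
    · simp
  induction h generalizing C with
  | step CT CT' r hm _ ih =>
    obtain ⟨C', hCC', hC'⟩ := key C CT CT' hm hC
    refine .step _ (Fin.append b C') _ (DCopMove.append (DCopMove.refl G b) hCC')
      fun r' hr' => ?_
    by_cases hT : r' ∈ T
    · exact ih ⟨r', hT⟩ (hr'.imp (fun h => Subtype.ext h) id) C' hC'
    · exact hout r r.2 r' hT (hr'.resolve_left fun h => hT (h ▸ r.2)) _
  | _ CT CT' r hm i hi =>
    obtain ⟨C', hCC', hC'⟩ := key C CT CT' hm hC
    exact .catch _ (Fin.append b C') _ (DCopMove.append (DCopMove.refl G b) hCC')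
      (Fin.natAdd k (Fin.castLE hc i)) (by rw [Fin.append_right, hC', hi])

end Guards

/-- The strong component of `r` in the digraph `E`, as a subset of a digraph `G ⊇ E`. -/
theorem stronglyConnected_induce_component {G : Digraph V} {E : V → V → Prop}
    (hE : ∀ x y, E x y → G.Adj x y) (r : V) :
    (G.induce {x | ReflTransGen E r x ∧ ReflTransGen E x r}).StronglyConnected := by
  rintro ⟨x, hx⟩ ⟨y, hy⟩
  have h : ReflTransGen E x y := hx.2.trans hy.1
  induction h using ReflTransGen.head_induction_on with
  | refl => exact .refl
  | @head x z hxz hzy ih =>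
    have hz : z ∈ {x | ReflTransGen E r x ∧ ReflTransGen E x r} :=
      ⟨hx.1.tail hxz, hzy.trans hy.2⟩
    exact .head (b := ⟨z, hz⟩) (hE _ _ hxz) (ih hz)

/-- Guarding with `k` stationary cops at `b` confines the robber to a strongly connected set
avoiding the closed out-neighbourhood of `b`. -/
theorem exists_dCopNumber_le_add [Finite V] {G : Digraph V} (hG : G.StronglyConnected)
    {k : ℕ} (b : Fin k → V) :
    ∃ T : Set V, (G.induce T).StronglyConnected ∧
      (∀ x ∈ T, ∀ i, ¬ (x = b i ∨ G.Adj (b i) x)) ∧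
      dCopNumber G ≤ k + dCopNumber (G.induce T) := by
  obtain ⟨T₀, ⟨hT₀, hT₀'⟩, hmax⟩ := Set.exists_max_image
    {T : Set V | (G.induce T).StronglyConnected ∧ ∀ x ∈ T, ∀ i, ¬ (x = b i ∨ G.Adj (b i) x)}
    (fun T => dCopNumber (G.induce T)) (Set.toFinite _) ⟨∅, fun u => u.2.elim, by simp⟩
  refine ⟨T₀, hT₀, hT₀', ?_⟩
  rcases isEmpty_or_nonempty V with hV | ⟨⟨v⟩⟩
  · exact (Nat.sInf_le ⟨Fin.elim0, fun r => hV.elim r⟩ :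
      dCopNumber G ≤ 0).trans (Nat.zero_le _)
  set m := dCopNumber (G.induce T₀) with hm
  let E : V → V → Prop := fun x y => G.Adj x y ∧ ∀ i, ¬ (y = b i ∨ G.Adj (b i) y)
  suffices main : ∀ (N : ℕ) (r : V), {x | ReflTransGen E r x}.ncard = N →
      ∀ C : Fin m → V, DCopsWin G (k + m) (Fin.append b C) r from
    Nat.sInf_le ⟨Fin.append b fun _ => v, fun r => main _ r rfl _⟩
  intro N
  induction N using Nat.strong_induction_on with
  | _ N IH =>
  intro r hN C
  by_cases hr : ∃ i, r = b i ∨ G.Adj (b i) r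
  · exact win_of_guarded hr.choose_spec C
  push Not at hr
  set T : Set V := {x | ReflTransGen E r x ∧ ReflTransGen E x r} with hT
  have hrT : r ∈ T := ⟨.refl, .refl⟩
  have hout : ∀ x ∈ T, ∀ y ∉ T, G.Adj x y → ∀ C : Fin m → V,
      DCopsWin G (k + m) (Fin.append b C) y := by
    intro x hx y hy hxy C
    by_cases hyb : ∃ i, y = b i ∨ G.Adj (b i) y
    · exact win_of_guarded hyb.choose_spec C
    have hry : ReflTransGen E r y := hx.1.tail ⟨hxy, not_exists.1 hyb⟩
    refine IH _ ?_ y rfl C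
    rw [← hN]
    refine Set.ncard_lt_ncard ⟨fun z hz => hry.trans hz, fun h => hy ⟨hry, ?_⟩⟩ (Set.toFinite _)
    exact h (ReflTransGen.refl : ReflTransGen E r r)
  have hTmem : (G.induce T).StronglyConnected ∧ ∀ x ∈ T, ∀ i, ¬ (x = b i ∨ G.Adj (b i) x) := by
    refine ⟨stronglyConnected_induce_component (fun _ _ h => h.1) r, fun x hx i => ?_⟩
    rcases hx.1.cases_tail with rfl | ⟨z, _, hz⟩
    · simpa using hr i
    · exact hz.2 i
  have hle : dCopNumber (G.induce T) ≤ m := hmax T hTmem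
  obtain ⟨CT, hCT⟩ := exists_win_dCopNumber (G.induce T)
  let C' : Fin m → V := fun j => if hj : j.1 < dCopNumber (G.induce T) then CT ⟨j, hj⟩ else v
  refine win_of_reflTransGen hout (reflTransGen_dCopMove hG C C') (fun s hs => ?_) r hrT
  exact win_of_induce hout hle (hCT ⟨s, hs⟩) C' fun i => by simp [C']

/-- A strongly connected set avoiding `∂⁻S` lies inside `S` or outside `S`. -/
theorem subset_or_disjoint_of_inBoundary {G : Digraph V} {S T : Set V}
    (hT : (G.induce T).StronglyConnected) (h : ∀ x ∈ T, x ∉ inBoundary G S) :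
    T ⊆ S ∨ Disjoint T S := by
  rw [or_iff_not_imp_right, Set.not_disjoint_iff]
  rintro ⟨y, hyT, hyS⟩ x hxT
  have hmem (a : T) (ha : ReflTransGen (G.induce T).Adj a ⟨y, hyT⟩) : a.1 ∈ S := by
    induction ha using ReflTransGen.head_induction_on with
    | refl => exact hyS
    | @head a c hac _ ih => exact by_contra fun ha => h a a.2 ⟨ha, c, ih, hac⟩
  exact hmem ⟨x, hxT⟩ (hT _ _)

end CopsAndRobbers

open CopsAndRobbers

/-- Corollary 5: for every strongly connected digraph `D` on `n` vertices and
every `0 < p < 1` there is an induced subdigraph `D'` on `m ≤ n` vertices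
which is strongly connected, has maximum out-degree at most `1/p`, is a
`p`-in-expander, and satisfies `c(D) ≤ pn + c(D')`. -/
theorem dCopNumber_nice_reduction {V : Type} [Fintype V] (D : Digraph V)
    (n : ℕ) (hn : Fintype.card V = n) (hconn : D.StronglyConnected)
    (p : ℝ) (hp0 : 0 < p) (hp1 : p < 1) :
    ∃ U : Set V, U.ncard ≤ n ∧
      (D.induce U).StronglyConnected ∧
      (∀ v : U, ({w : U | (D.induce U).Adj v w}.ncard : ℝ) ≤ 1 / p) ∧
      (D.induce U).IsInExpander p ∧
      (dCopNumber D : ℝ) ≤ p * n + dCopNumber (D.induce U) := by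
  obtain ⟨U, ⟨hU, hUc⟩, hmin⟩ := exists_minimal_of_wellFoundedLT
    (fun U : Set V => (D.induce U).StronglyConnected ∧
      (dCopNumber D : ℝ) ≤ p * (n - U.ncard) + dCopNumber (D.induce U))
    ⟨Set.univ, by
      let e : D.Adj ≃r (D.induce Set.univ).Adj := ⟨(Equiv.Set.univ V).symm, Iff.rfl⟩
      refine ⟨stronglyConnected_of_relIso e hconn, ?_⟩
      rw [Set.ncard_univ, Nat.card_eq_fintype_card, hn, sub_self, mul_zero, zero_add]
      exact_mod_cast dCopNumber_le_of_relIso e.symm⟩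
  have hUn : U.ncard ≤ n := by
    rw [← hn, ← Nat.card_eq_fintype_card]
    exact Set.ncard_le_card U
  have hcardU : Nat.card U = U.ncard := Nat.card_coe_set_eq U
  have key (T : Set U) (hT : ((D.induce U).induce T).StronglyConnected) (k : ℕ)
      (hk : dCopNumber (D.induce U) ≤ k + dCopNumber ((D.induce U).induce T))
      (X : Set U) (hX : Disjoint T X) : p * X.ncard ≤ k := by
    by_contra! hlt
    have e := induceInduceRelIso D U T
    have hle := dCopNumber_le_of_relIso e.symm
    have hsum : T.ncard + X.ncard ≤ U.ncard := by
      rw [← Set.ncard_union_eq hX, ← hcardU]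
      exact Set.ncard_le_card _
    have himg : (Subtype.val '' T).ncard = T.ncard :=
      Set.ncard_image_of_injective _ Subtype.val_injective
    have hsumR : (T.ncard : ℝ) + X.ncard ≤ U.ncard := by exact_mod_cast hsum
    have hkR : (dCopNumber (D.induce U) : ℝ) ≤ k + dCopNumber (D.induce (Subtype.val '' T)) := by
      exact_mod_cast hk.trans (Nat.add_le_add_left hle k)
    have hsub := hmin (y := Subtype.val '' T) ⟨stronglyConnected_of_relIso e hT, by
      rw [himg]
      have := mul_le_mul_of_nonneg_left hsumR hp0.le
      linarith⟩ (by rintro _ ⟨x, _, rfl⟩; exact x.2)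
    have hUT := Set.ncard_le_ncard hsub (Set.toFinite _)
    have hX0 : X.ncard = 0 := by omega
    rw [hX0] at hlt
    simp only [Nat.cast_zero, mul_zero] at hlt
    exact absurd hlt (not_lt.2 k.cast_nonneg)
  refine ⟨U, hUn, hU, fun v => ?_, fun S hS => ?_, ?_⟩
  · obtain ⟨T, hT, hTb, hk⟩ := exists_dCopNumber_le_add hU (k := 1) fun _ => v
    have := key T hT 1 hk {w | (D.induce U).Adj v w}
      (Set.disjoint_left.2 fun x hx h => hTb x hx 0 (Or.inr h))
    rwa [le_div_iff₀ hp0, mul_comm, ← Nat.cast_one]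
  · let B := inBoundary (D.induce U) S
    let b : Fin B.ncard → U := fun i => (Finite.equivFinOfCardEq (Nat.card_coe_set_eq B)).symm i
    obtain ⟨T, hT, hTb, hk⟩ := exists_dCopNumber_le_add hU b
    have hTB : ∀ x ∈ T, x ∉ B := fun x hx hxB =>
      hTb x hx (Finite.equivFinOfCardEq (Nat.card_coe_set_eq B) ⟨x, hxB⟩) (Or.inl (by simp [b]))
    rcases subset_or_disjoint_of_inBoundary hT hTB with hTS | hTS
    · have hcompl := key T hT _ hk Sᶜ (Set.disjoint_compl_right_iff_subset.2 hTS)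
      refine le_trans (mul_le_mul_of_nonneg_left ?_ hp0.le) hcompl
      have hadd : (S.ncard : ℝ) + Sᶜ.ncard = Nat.card U := by
        exact_mod_cast Set.ncard_add_ncard_compl S
      linarith
    · exact key T hT _ hk S hTS
  · have := mul_nonneg hp0.le (Nat.cast_nonneg (α := ℝ) U.ncard)
    rw [mul_sub] at hUc
    linarith
end

section
/- Let p = p(n) = 13·(log log n)² / log n. For all sufficiently large n the following holds: every strongly connected digraph D on m ≤ n vertices whose maximum out-degree is at most 1/p and in which every vertex set S with |S| ≤ m/2 satisfies |∂⁻S| ≥ p·|S|, has cop number c(D) ≤ 2·p·n. -/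
/-- `DReach D j u v`: there is a directed walk from `u` to `v` with at most `j` edges. -/
def DReach {V : Type*} (D : Digraph V) : ℕ → V → V → Prop
  | 0, u, v => u = v
  | j + 1, u, v => ∃ w, (w = u ∨ D.Adj u w) ∧ DReach D j w v

lemma DReach.refl {V : Type*} (D : Digraph V) (j : ℕ) (u : V) : DReach D j u u := by
  induction j with
  | zero => rfl
  | succ j ih => exact ⟨u, Or.inl rfl, ih⟩

/-- If the cops can simultaneously reach within `j + 1` steps positions covering every vertex that
the robber can reach within `j` steps, then the cops win. -/
lemma DCopsWin.of_targets {V : Type*} (D : Digraph V) {c : ℕ} (g : Fin c → V) (j : ℕ) :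
    ∀ (C : Fin c → V) (r : V), (∀ i, DReach D (j + 1) (C i) (g i)) →
      (∀ u, DReach D j r u → ∃ i, g i = u) → DCopsWin D c C r := by
  induction j with
  | zero =>
    intro C r hC hr
    obtain ⟨i, hi⟩ := hr r rfl
    refine DCopsWin.catch C g r (fun i => ?_) i hi
    obtain ⟨w, hw, rfl⟩ := hC i
    exact hw
  | succ j ih =>
    intro C r hC hr
    choose C' hC' hreach using hC
    exact DCopsWin.step C C' r hC' fun r' hr' =>
      ih C' r' hreach fun u hu => hr u ⟨r', hr', hu⟩

/-- Hall's condition for matching the robber's out-ball into the cops yields a win. -/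
lemma DCopsWin.of_hall {V : Type*} [Fintype V] (D : Digraph V) {c : ℕ} (j : ℕ) (C : Fin c → V)
    (r : V)
    (h : ∀ S : Finset V, (∀ u ∈ S, DReach D j r u) →
      S.card ≤ {i : Fin c | ∃ u ∈ S, DReach D (j + 1) (C i) u}.ncard) :
    DCopsWin D c C r := by
  classical
  let t : {u // DReach D j r u} → Finset (Fin c) := fun u =>
    Finset.univ.filter fun i => DReach D (j + 1) (C i) u
  obtain ⟨φ, hφ, hmem⟩ := (Finset.all_card_le_biUnion_card_iff_exists_injective t).1 (by
    intro S
    have := h (S.map (Function.Embedding.subtype _)) (by simp +contextual)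
    rw [Finset.card_map] at this
    refine this.trans (le_of_eq ?_)
    rw [← Set.ncard_coe_finset]
    congr 1
    ext i
    simp [t])
  refine DCopsWin.of_targets D
    (fun i => if hi : ∃ u, φ u = i then (hi.choose : V) else C i) j C r (fun i => ?_) ?_
  · by_cases hi : ∃ u, φ u = i
    · simp only [hi, dif_pos]
      have := hmem hi.choose
      rw [hi.choose_spec] at this
      simpa [t] using this
    · simp only [hi, dif_neg, not_false_eq_true]
      exact DReach.refl D _ _
  · intro u hu
    have hi : ∃ u', φ u' = φ ⟨u, hu⟩ := ⟨_, rfl⟩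
    refine ⟨φ ⟨u, hu⟩, ?_⟩
    simp only [hi, dif_pos]
    exact congrArg Subtype.val (hφ hi.choose_spec)

/-- The out-ball of radius `j` has size at most `b ^ j` if every closed out-neighbourhood has size
at most `b`. -/
lemma ncard_dReach_le {V : Type*} [Fintype V] (D : Digraph V) (b : ℝ)
    (hb : ∀ v : V, ({w : V | D.Adj v w}.ncard : ℝ) + 1 ≤ b) (j : ℕ) (v : V) :
    ({u : V | DReach D j v u}.ncard : ℝ) ≤ b ^ j := by
  classical
  induction j generalizing v with
  | zero => simp [DReach]
  | succ j ih =>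
    set N : Finset V := insert v (Finset.univ.filter fun w => D.Adj v w) with hN
    have hNb : (N.card : ℝ) ≤ b := by
      refine le_trans ?_ (hb v)
      have h1 := Finset.card_insert_le v (Finset.univ.filter fun w => D.Adj v w)
      have h2 : {w : V | D.Adj v w}.ncard = (Finset.univ.filter fun w => D.Adj v w).card := by
        rw [← Set.ncard_coe_finset]; simp
      rw [h2]
      exact_mod_cast h1
    have hb0 : 0 ≤ b := (Nat.cast_nonneg _).trans hNb
    have hset : {u : V | DReach D (j + 1) v u} =
        ((N.biUnion fun w => Finset.univ.filter fun u => DReach D j w u : Finset V) : Set V) := by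
      ext u
      simp [DReach, hN]
    rw [hset, Set.ncard_coe_finset]
    calc ((N.biUnion fun w => Finset.univ.filter fun u => DReach D j w u).card : ℝ)
        ≤ ∑ w ∈ N, ((Finset.univ.filter fun u => DReach D j w u).card : ℝ) := by
          exact_mod_cast Finset.card_biUnion_le
      _ ≤ ∑ _w ∈ N, b ^ j := by
          refine Finset.sum_le_sum fun w _ => ?_
          have := ih w
          rw [← Set.ncard_coe_finset]
          simpa using this
      _ = N.card * b ^ j := by simp
      _ ≤ b * b ^ j := by gcongr
      _ = b ^ (j + 1) := by ring

/-- In an expander, in-balls grow geometrically until they contain more than half of the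
vertices. -/
lemma ncard_inBall_ge {V : Type*} [Fintype V] (D : Digraph V) (p M : ℝ) (hp : 0 ≤ p)
    (hexp : ∀ S : Set V, (S.ncard : ℝ) ≤ M → p * S.ncard ≤ ((inBoundary D S).ncard : ℝ))
    (S : Set V) (j : ℕ) :
    M < ({v | ∃ u ∈ S, DReach D j v u}.ncard : ℝ) ∨
      (1 + p) ^ j * S.ncard ≤ ({v | ∃ u ∈ S, DReach D j v u}.ncard : ℝ) := by
  induction j with
  | zero =>
    right
    simp [DReach]
  | succ j ih =>
    set T := {v | ∃ u ∈ S, DReach D j v u} with hT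
    have hset : {v | ∃ u ∈ S, DReach D (j + 1) v u} = T ∪ inBoundary D T := by
      ext v
      simp only [DReach, Set.mem_ofPred_eq, Set.mem_union, inBoundary, hT]
      constructor
      · rintro ⟨u, hu, w, rfl | hw, hr⟩
        · exact Or.inl ⟨u, hu, hr⟩
        · by_cases hv : ∃ u ∈ S, DReach D j v u
          · exact Or.inl hv
          · exact Or.inr ⟨hv, w, ⟨u, hu, hr⟩, hw⟩
      · rintro (⟨u, hu, hr⟩ | ⟨-, w, ⟨u, hu, hr⟩, hw⟩)
        · exact ⟨u, hu, v, Or.inl rfl, hr⟩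
        · exact ⟨u, hu, w, Or.inr hw, hr⟩
    have hcard : ((T ∪ inBoundary D T).ncard : ℝ) = T.ncard + (inBoundary D T).ncard := by
      rw [Set.ncard_union_eq (Set.disjoint_left.2 fun v hv hb => hb.1 hv)]
      push_cast
      rfl
    rw [hset, hcard]
    have hnn : (0 : ℝ) ≤ (inBoundary D T).ncard := Nat.cast_nonneg _
    by_cases hM : M < T.ncard
    · left; linarith
    · right
      have h1 := hexp T (not_lt.1 hM)
      have h2 := ih.resolve_left hM
      calc (1 + p) ^ (j + 1) * S.ncard = (1 + p) * ((1 + p) ^ j * S.ncard) := by ring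
        _ ≤ (1 + p) * T.ncard := by gcongr
        _ ≤ _ := by linarith

/-- First-moment argument for `k` independent uniformly random vertices: if the (exponential Markov)
failure probabilities sum to less than `1`, some placement hits each `T a` at least `s a` times. -/
lemma exists_placement {V ι : Type*} [Fintype V] [Nonempty V] [DecidableEq V] (k : ℕ)
    (F : Finset ι) (T : ι → Finset V) (s : ι → ℕ)
    (h : ∑ a ∈ F, (2 : ℝ) ^ s a * (1 - (T a).card / (2 * Fintype.card V)) ^ k < 1) :
    ∃ f : Fin k → V, ∀ a ∈ F, s a ≤ (Finset.univ.filter fun i => f i ∈ T a).card := by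
  by_contra! hcon
  have hm : (0 : ℝ) < Fintype.card V := by exact_mod_cast Fintype.card_pos
  have hweight : ∀ a, ∑ f : Fin k → V, ∏ i, (if f i ∈ T a then (1 / 2 : ℝ) else 1) =
      (Fintype.card V : ℝ) ^ k * (1 - (T a).card / (2 * Fintype.card V)) ^ k := by
    intro a
    rw [← Fintype.sum_pow (fun v => if v ∈ T a then (1 / 2 : ℝ) else 1), ← mul_pow]
    congr 1
    have : ∀ v, (if v ∈ T a then (1 / 2 : ℝ) else 1) = 1 - (if v ∈ T a then (1 / 2 : ℝ) else 0) := by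
      intro v; split_ifs <;> norm_num
    simp_rw [this]
    rw [Finset.sum_sub_distrib, ← Finset.sum_filter]
    simp
    field_simp
  have hone : ∀ f : Fin k → V, (1 : ℝ) ≤
      ∑ a ∈ F, 2 ^ s a * ∏ i, (if f i ∈ T a then (1 / 2 : ℝ) else 1) := by
    intro f
    obtain ⟨a, ha, hlt⟩ := hcon f
    have hnn : ∀ b ∈ F, (0 : ℝ) ≤ 2 ^ s b * ∏ i, (if f i ∈ T b then (1 / 2 : ℝ) else 1) := by
      intro b _
      refine mul_nonneg (by positivity) (Finset.prod_nonneg fun i _ => ?_)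
      split_ifs <;> norm_num
    refine le_trans ?_ (Finset.single_le_sum hnn ha)
    rw [← Finset.prod_filter, Finset.prod_const, one_div, inv_pow, ← div_eq_mul_inv,
      one_le_div (by positivity)]
    exact pow_le_pow_right₀ (by norm_num) hlt.le
  have hsum : ((Fintype.card V : ℝ)) ^ k ≤ (Fintype.card V : ℝ) ^ k *
      ∑ a ∈ F, (2 : ℝ) ^ s a * (1 - (T a).card / (2 * Fintype.card V)) ^ k := by
    calc ((Fintype.card V : ℝ)) ^ k = ∑ _f : Fin k → V, (1 : ℝ) := by simp
      _ ≤ ∑ f : Fin k → V, ∑ a ∈ F, 2 ^ s a * ∏ i, (if f i ∈ T a then (1 / 2 : ℝ) else 1) :=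
          Finset.sum_le_sum fun f _ => hone f
      _ = ∑ a ∈ F, 2 ^ s a * ∑ f : Fin k → V, ∏ i, (if f i ∈ T a then (1 / 2 : ℝ) else 1) := by
          rw [Finset.sum_comm]
          simp_rw [Finset.mul_sum]
      _ = _ := by
          rw [Finset.mul_sum]
          refine Finset.sum_congr rfl fun a _ => ?_
          rw [hweight]
          ring
  have := mul_lt_mul_of_pos_left h (pow_pos hm k)
  linarith

lemma exp_half_le_one_add {x : ℝ} (h0 : 0 ≤ x) (h1 : x ≤ 1) : Real.exp (x / 2) ≤ 1 + x := by
  have := Real.exp_bound_div_one_sub_of_interval (x := x / 2) (by linarith) (by linarith)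
  refine this.trans ?_
  rw [div_le_iff₀ (by linarith)]
  nlinarith

/-- If in-balls of radius `j + 1` around small sets `S` have size at least proportional to
`S.card * log n`, then some placement of `k` cops wins. -/
lemma exists_winning_placement {V : Type*} [Fintype V] [Nonempty V] (D : Digraph V) (n k j : ℕ)
    (hm : Fintype.card V ≤ n) (B : ℝ) (hB : 4 * B < n)
    (hball : ∀ v : V, ({u : V | DReach D j v u}.ncard : ℝ) ≤ B)
    (hin : ∀ S : Finset V, S.Nonempty → (S.card : ℝ) ≤ B →
      2 * Real.log n * S.card ≤
        k * ({v | ∃ u ∈ S, DReach D (j + 1) v u}.ncard / (2 * Fintype.card V))) :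
    ∃ C : Fin k → V, ∀ r : V, DCopsWin D k C r := by
  classical
  have hmpos : (0 : ℝ) < Fintype.card V := by exact_mod_cast Fintype.card_pos
  have hmn : (Fintype.card V : ℝ) ≤ n := by exact_mod_cast hm
  have hn : (0 : ℝ) < n := hmpos.trans_le hmn
  have hn1 : (1 : ℝ) ≤ n := by exact_mod_cast (Nat.cast_pos.1 hn : 0 < n)
  let ball : V → Finset V := fun v => Finset.univ.filter fun u => DReach D j v u
  have hball' : ∀ v, ((ball v).card : ℝ) ≤ B := by
    intro v
    rw [← Set.ncard_coe_finset]
    simpa [ball] using hball v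
  let F : Finset (V × Finset V) :=
    Finset.univ.filter fun a => a.2 ∈ (ball a.1).powerset.erase ∅
  let T : V × Finset V → Finset V := fun a =>
    Finset.univ.filter fun v => ∃ u ∈ a.2, DReach D (j + 1) v u
  have hT : ∀ a, (T a).card = {v | ∃ u ∈ a.2, DReach D (j + 1) v u}.ncard := by
    intro a
    rw [← Set.ncard_coe_finset]
    simp [T]
  have hterm : ∀ v, ∀ S ∈ (ball v).powerset.erase ∅,
      (2 : ℝ) ^ S.card * (1 - (T (v, S)).card / (2 * Fintype.card V)) ^ k ≤
        (2 / (n : ℝ) ^ 2) ^ S.card := by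
    intro v S hS
    rw [Finset.mem_erase, Finset.mem_powerset] at hS
    have hSB : (S.card : ℝ) ≤ B :=
      le_trans (by exact_mod_cast Finset.card_le_card hS.2) (hball' v)
    have h1 := hin S (Finset.nonempty_iff_ne_empty.2 hS.1) hSB
    rw [← hT (v, S)] at h1
    set τ : ℝ := (T (v, S)).card / (2 * Fintype.card V) with hτ
    have hτ1 : τ ≤ 1 := by
      rw [hτ, div_le_one (by positivity)]
      have : ((T (v, S)).card : ℝ) ≤ Fintype.card V := by exact_mod_cast Finset.card_le_univ _
      linarith
    have h2 : (1 - τ) ^ k ≤ Real.exp (-(k * τ)) := by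
      calc (1 - τ) ^ k ≤ (Real.exp (-τ)) ^ k := by
            exact pow_le_pow_left₀ (by linarith) (Real.one_sub_le_exp_neg τ) k
        _ = Real.exp (-(k * τ)) := by rw [← Real.exp_nat_mul]; ring_nf
    have h3 : Real.exp (-(k * τ)) ≤ (1 / (n : ℝ) ^ 2) ^ S.card := by
      calc Real.exp (-(k * τ)) ≤ Real.exp (S.card * (-(2 * Real.log n))) := by
            apply Real.exp_le_exp.2
            linarith
        _ = (1 / (n : ℝ) ^ 2) ^ S.card := by
            rw [Real.exp_nat_mul, Real.exp_neg, two_mul, Real.exp_add, Real.exp_log hn, one_div,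
              sq]
    calc (2 : ℝ) ^ S.card * (1 - τ) ^ k ≤ 2 ^ S.card * (1 / (n : ℝ) ^ 2) ^ S.card := by
          gcongr
          exact h2.trans h3
      _ = _ := by rw [← mul_pow]; ring_nf
  have hv : ∀ v, ∑ S ∈ (ball v).powerset.erase ∅,
      (2 : ℝ) ^ S.card * (1 - (T (v, S)).card / (2 * Fintype.card V)) ^ k < 1 / n := by
    intro v
    have hsum : ∑ S ∈ (ball v).powerset, (2 / (n : ℝ) ^ 2) ^ S.card =
        (2 / (n : ℝ) ^ 2 + 1) ^ (ball v).card := by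
      rw [← Finset.sum_pow_mul_eq_add_pow]
      simp
    have hsplit := Finset.add_sum_erase (ball v).powerset
      (fun S => (2 / (n : ℝ) ^ 2) ^ S.card) (Finset.empty_mem_powerset _)
    simp only [Finset.card_empty, pow_zero] at hsplit
    have hle := Finset.sum_le_sum (hterm v)
    have hexp : (2 / (n : ℝ) ^ 2 + 1) ^ (ball v).card < 1 + 1 / n := by
      calc (2 / (n : ℝ) ^ 2 + 1) ^ (ball v).card ≤ (Real.exp (2 / (n : ℝ) ^ 2)) ^ (ball v).card := by
            gcongr
            exact Real.add_one_le_exp _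
        _ = Real.exp ((ball v).card * (2 / (n : ℝ) ^ 2)) := by rw [← Real.exp_nat_mul]
        _ < Real.exp (1 / n / 2) := by
            apply Real.exp_lt_exp.2
            have := hball' v
            rw [mul_div_assoc', div_div, div_lt_div_iff₀ (by positivity) (by positivity)]
            nlinarith
        _ ≤ 1 + 1 / n := exp_half_le_one_add (by positivity) (by
            rw [div_le_one hn]; exact hn1)
    linarith
  have htotal : ∑ a ∈ F, (2 : ℝ) ^ a.2.card * (1 - (T a).card / (2 * Fintype.card V)) ^ k < 1 := by
    calc ∑ a ∈ F, (2 : ℝ) ^ a.2.card * (1 - (T a).card / (2 * Fintype.card V)) ^ k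
        = ∑ v, ∑ S ∈ (ball v).powerset.erase ∅,
            (2 : ℝ) ^ S.card * (1 - (T (v, S)).card / (2 * Fintype.card V)) ^ k := by
          apply Finset.sum_finset_product
          simp [F]
      _ < ∑ _v : V, 1 / (n : ℝ) :=
          Finset.sum_lt_sum_of_nonempty Finset.univ_nonempty fun v _ => hv v
      _ = Fintype.card V / n := by simp [div_eq_mul_inv]
      _ ≤ 1 := by rw [div_le_one hn]; exact hmn
  obtain ⟨C, hC⟩ := exists_placement k F T (fun a => a.2.card) htotal
  refine ⟨C, fun r => DCopsWin.of_hall D j C r fun S hS => ?_⟩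
  rcases S.eq_empty_or_nonempty with rfl | hne
  · simp
  · have hmem : (r, S) ∈ F := by
      simp only [F, Finset.mem_filter, Finset.mem_univ, true_and, Finset.mem_erase,
        Finset.mem_powerset]
      exact ⟨hne.ne_empty, fun u hu => by simpa [ball] using hS u hu⟩
    refine (hC _ hmem).trans (le_of_eq ?_)
    rw [← Set.ncard_coe_finset]
    congr 1
    ext i
    simp [T]

lemma eventually_log_bounds : ∀ᶠ n : ℕ in Filter.atTop,
    2 ≤ Real.log (Real.log n) ∧ 13 * (Real.log (Real.log n)) ^ 2 ≤ Real.log n ∧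
      Real.log n ^ 2 ≤ Real.sqrt n ∧ (64 : ℝ) ≤ n := by
  have hcast : Filter.Tendsto (fun n : ℕ => (n : ℝ)) Filter.atTop Filter.atTop :=
    tendsto_natCast_atTop_atTop
  have hlog := Real.tendsto_log_atTop.comp hcast
  have hloglog := Real.tendsto_log_atTop.comp hlog
  have hsq : ∀ᶠ x : ℝ in Filter.atTop, 13 * Real.log x ^ 2 ≤ x := by
    have := (isLittleO_log_rpow_atTop (r := 1 / 2) (by norm_num)).bound
      (c := 1 / 4) (by norm_num)
    filter_upwards [this, Filter.eventually_ge_atTop 1] with x hx hx1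
    rw [← Real.sqrt_eq_rpow, Real.norm_of_nonneg (Real.log_nonneg hx1),
      Real.norm_of_nonneg (Real.sqrt_nonneg x)] at hx
    have := Real.sq_sqrt (zero_le_one.trans hx1)
    nlinarith [Real.log_nonneg hx1, pow_le_pow_left₀ (Real.log_nonneg hx1) hx 2]
  have hquart : ∀ᶠ x : ℝ in Filter.atTop, Real.log x ^ 2 ≤ Real.sqrt x := by
    have := (isLittleO_log_rpow_atTop (r := 1 / 4) (by norm_num)).bound
      (c := 1) (by norm_num)
    filter_upwards [this, Filter.eventually_ge_atTop 1] with x hx hx1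
    have hx0 : 0 ≤ x := zero_le_one.trans hx1
    rw [Real.norm_of_nonneg (Real.log_nonneg hx1),
      Real.norm_of_nonneg (Real.rpow_nonneg hx0 _), one_mul] at hx
    calc Real.log x ^ 2 ≤ (x ^ (1 / 4 : ℝ)) ^ 2 :=
          pow_le_pow_left₀ (Real.log_nonneg hx1) hx 2
      _ = Real.sqrt x := by
          rw [← Real.rpow_natCast, ← Real.rpow_mul hx0, Real.sqrt_eq_rpow]
          norm_num
  filter_upwards [hloglog.eventually_ge_atTop 2, hlog.eventually hsq, hcast.eventually hquart,
    hcast.eventually_ge_atTop 64] with n h1 h2 h3 h4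
  exact ⟨h1, h2, h3, h4⟩

/-- The choice of radius: balls of out-degree about `x` stay below `exp (x / 2)`, while expansion
`1 + p` with `p = 13 * y ^ 2 / x` gains a factor `4 * x / p`. -/
lemma exists_radius {x y : ℝ} (hy : 2 ≤ y) (hxy : 13 * y ^ 2 ≤ x) (hxexp : Real.exp y = x) :
    ∃ t : ℕ, (x ^ t) ^ 2 ≤ Real.exp x ∧
      4 * x ≤ 13 * y ^ 2 / x * (1 + 13 * y ^ 2 / x) ^ (t + 1) := by
  have hx52 : 52 ≤ x := by nlinarith
  have hx0 : 0 < x := by linarith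
  set p := 13 * y ^ 2 / x with hp
  have hp0 : 0 < p := by positivity
  have hp1 : p ≤ 1 := by rw [hp, div_le_one hx0]; exact hxy
  have hpx : p * x = 13 * y ^ 2 := by rw [hp]; field_simp
  set t := ⌊x / (2 * y)⌋₊ with ht
  have hty : t * y ≤ x / 2 := by
    have : (t : ℝ) ≤ x / (2 * y) := Nat.floor_le (by positivity)
    rw [le_div_iff₀ (by positivity)] at this
    linarith
  have htp : 6 * y ≤ t * p := by
    have h1 : x / (2 * y) < t + 1 := Nat.lt_floor_add_one _
    rw [div_lt_iff₀ (by positivity)] at h1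
    have h2 : 6 * x ≤ t * (13 * y) := by nlinarith
    rw [hp, mul_div_assoc', le_div_iff₀ hx0]
    nlinarith
  refine ⟨t, ?_, ?_⟩
  · calc (x ^ t) ^ 2 = Real.exp (2 * (t * y)) := by
          rw [two_mul, Real.exp_add, Real.exp_nat_mul, hxexp, sq]
      _ ≤ Real.exp x := Real.exp_le_exp.2 (by linarith)
  have hgrow : x ^ 3 ≤ (1 + p) ^ t := by
    calc x ^ 3 = Real.exp ((3 : ℕ) * y) := by rw [Real.exp_nat_mul, hxexp]
      _ ≤ Real.exp (t * (p / 2)) := Real.exp_le_exp.2 (by push_cast; linarith)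
      _ = Real.exp (p / 2) ^ t := by rw [Real.exp_nat_mul]
      _ ≤ (1 + p) ^ t := by
          gcongr
          exact exp_half_le_one_add hp0.le hp1
  have h1 : (1 + p) ^ t ≤ (1 + p) ^ (t + 1) := pow_le_pow_right₀ (by linarith) (by omega)
  calc 4 * x ≤ 13 * y ^ 2 * x := by gcongr; nlinarith
    _ ≤ 13 * y ^ 2 * x ^ 2 := by gcongr; nlinarith
    _ = p * x ^ 3 := by rw [← hpx]; ring
    _ ≤ _ := by gcongr; exact hgrow.trans h1

/-- Lemma 6: with `p = 13 (log log n)² / log n`, for all sufficiently large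
`n`, every strongly connected digraph on `m ≤ n` vertices with maximum
out-degree at most `1/p` and in-expansion at least `p` has cop number at most
`2pn`. -/
theorem dCopNumber_expander_bound :
    ∃ N : ℕ, ∀ n : ℕ, N ≤ n →
      ∀ (V : Type) [Fintype V], ∀ m : ℕ, Fintype.card V = m → m ≤ n →
        ∀ D : Digraph V, D.StronglyConnected →
          (∀ v : V, ({w : V | D.Adj v w}.ncard : ℝ) ≤
            1 / (13 * (Real.log (Real.log n)) ^ 2 / Real.log n)) →
          (∀ S : Set V, (S.ncard : ℝ) ≤ m / 2 →
            13 * (Real.log (Real.log n)) ^ 2 / Real.log n * S.ncard ≤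
              ((inBoundary D S).ncard : ℝ)) →
          (dCopNumber D : ℝ) ≤ 2 * (13 * (Real.log (Real.log n)) ^ 2 / Real.log n) * n := by
  obtain ⟨N, hN⟩ := Filter.eventually_atTop.1 eventually_log_bounds
  refine ⟨N, fun n hn V _ m hm hmn D _ hdeg hexp => ?_⟩
  obtain ⟨hy, hxy, hxs, hn64⟩ := hN n hn
  set x := Real.log n with hx
  set y := Real.log x with hydef
  set p := 13 * y ^ 2 / x with hp
  have hx52 : 52 ≤ x := by nlinarith
  have hx0 : 0 < x := by linarith
  have hn0 : (0 : ℝ) < n := by linarith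
  have hp0 : 0 < p := by positivity
  have hp1 : p ≤ 1 := by rw [hp, div_le_one hx0]; exact hxy
  have hpx : p * x = 13 * y ^ 2 := by rw [hp]; field_simp
  have hsn : Real.sqrt n * Real.sqrt n = n := Real.mul_self_sqrt hn0.le
  have hs8 : 8 ≤ Real.sqrt n := Real.le_sqrt_of_sq_le (by linarith)
  suffices h : ∃ k : ℕ, (k : ℝ) ≤ 2 * p * n ∧ ∃ C : Fin k → V, ∀ r : V, DCopsWin D k C r by
    obtain ⟨k, hk, hwin⟩ := h
    exact le_trans (by exact_mod_cast Nat.sInf_le hwin) hk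
  rcases isEmpty_or_nonempty V with hV | hV
  · exact ⟨0, by simp; positivity, Fin.elim0, fun r => isEmptyElim r⟩
  have hm0 : (0 : ℝ) < m := by rw [← hm]; exact_mod_cast Fintype.card_pos
  have hmn' : (m : ℝ) ≤ n := by exact_mod_cast hmn
  have hpsn : 8 * x ≤ p * Real.sqrt n := by
    have : p * x ^ 2 ≤ p * Real.sqrt n := by gcongr
    calc 8 * x ≤ 13 * y ^ 2 * x := by gcongr; nlinarith
      _ = p * x ^ 2 := by rw [← hpx]; ring
      _ ≤ _ := this
  have hpn : 1 ≤ p * n := by nlinarith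
  set k := ⌊2 * p * n⌋₊ with hk
  have hkle : (k : ℝ) ≤ 2 * p * n := Nat.floor_le (by positivity)
  have hkge : p * n ≤ k := by
    have := Nat.lt_floor_add_one (2 * p * n)
    rw [← hk] at this
    linarith
  refine ⟨k, hkle, ?_⟩
  obtain ⟨t, hBsq, hpgrow⟩ := exists_radius hy hxy (Real.exp_log hx0)
  rw [← hp] at hpgrow
  have hB : x ^ t ≤ Real.sqrt n :=
    Real.le_sqrt_of_sq_le (hBsq.trans_eq (Real.exp_log hn0))
  refine exists_winning_placement D n k t (hm.trans_le hmn) (x ^ t) (by nlinarith)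
    (ncard_dReach_le D x (fun v => ?_) t) ?_
  · have h1 := hdeg v
    have h2 : 1 / p ≤ x / 13 := by
      rw [div_le_div_iff₀ hp0 (by norm_num), mul_comm x p, hpx, one_mul]
      linarith [one_le_pow₀ (n := 2) (one_le_two.trans hy)]
    linarith
  · intro S hS hSB
    rw [hm]
    have hSc : (0 : ℝ) ≤ S.card := Nat.cast_nonneg _
    rcases ncard_inBall_ge D p (m / 2) hp0.le hexp (S : Set V) (t + 1) with h | h
    all_goals
      simp only [Finset.mem_coe] at h
      set Q : ℝ := ({v | ∃ u ∈ S, DReach D (t + 1) v u}.ncard : ℝ)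
    · calc 2 * x * S.card ≤ 2 * x * Real.sqrt n := by gcongr; exact hSB.trans hB
        _ = 8 * x * Real.sqrt n / 4 := by ring
        _ ≤ p * Real.sqrt n * Real.sqrt n / 4 := by gcongr
        _ = p * n / 4 := by rw [mul_assoc, hsn]
        _ ≤ k * (1 / 4) := by linarith
        _ ≤ k * (Q / (2 * m)) := by
            refine mul_le_mul_of_nonneg_left ?_ (Nat.cast_nonneg _)
            rw [div_le_div_iff₀ (by norm_num) (by positivity)]
            linarith
    · rw [Set.ncard_coe_finset] at h
      have hQ : 0 ≤ Q := Nat.cast_nonneg _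
      have hkm : p ≤ k / m := by
        rw [le_div_iff₀ hm0]
        exact (mul_le_mul_of_nonneg_left hmn' hp0.le).trans hkge
      calc 2 * x * S.card = 4 * x * S.card / 2 := by ring
        _ ≤ p * (1 + p) ^ (t + 1) * S.card / 2 := by gcongr
        _ = p * ((1 + p) ^ (t + 1) * S.card) / 2 := by ring
        _ ≤ k / m * Q / 2 := by gcongr
        _ = k * (Q / (2 * m)) := by field_simp
end

section
/- Let H be a bipartite graph with parts A and B, and let k ≥ 0 be a real number. Then A can be partitioned into two (possibly empty) sets S and T such that |N(S)| ≤ k·|S| and every subset U ⊆ T satisfies |N(U)| ≥ k·|U|, where N(X) denotes the set of vertices of B adjacent to at least one vertex of X. -/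
/-- For a bipartite graph with parts `A`, `B` given by the adjacency relation
`Adj : A → B → Prop`, `bipNeighborSet Adj X` is the set of vertices of `B`
adjacent to at least one vertex of `X ⊆ A`. -/
def bipNeighborSet {A B : Type*} (Adj : A → B → Prop) (X : Set A) : Set B :=
  {b | ∃ a ∈ X, Adj a b}

theorem bipNeighborSet_union {A B : Type*} (Adj : A → B → Prop) (X Y : Set A) :
    bipNeighborSet Adj (X ∪ Y) = bipNeighborSet Adj X ∪ bipNeighborSet Adj Y := by
  ext b
  simp only [bipNeighborSet, Set.mem_union, Set.mem_ofPred_eq, or_and_right, exists_or]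

theorem bipNeighborSet_empty {A B : Type*} (Adj : A → B → Prop) :
    bipNeighborSet Adj ∅ = ∅ := by
  simp [bipNeighborSet]

/-- Lemma 7: given a finite bipartite graph with parts `A` and `B` and a real
number `k ≥ 0`, the part `A` can be partitioned as `A = S ∪ T` such that
`|N(S)| ≤ k|S|` and every subset `U ⊆ T` satisfies `|N(U)| ≥ k|U|`. -/
theorem bipartite_split_hall {A B : Type} [Fintype A] [Fintype B]
    (Adj : A → B → Prop) (k : ℝ) (hk : 0 ≤ k) :
    ∃ S T : Set A, S ∪ T = Set.univ ∧ Disjoint S T ∧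
      ((bipNeighborSet Adj S).ncard : ℝ) ≤ k * S.ncard ∧
      ∀ U : Set A, U ⊆ T → k * U.ncard ≤ ((bipNeighborSet Adj U).ncard : ℝ) := by
  obtain ⟨S, hS⟩ := Finite.exists_min
    fun X : Set A => ((bipNeighborSet Adj X).ncard : ℝ) - k * X.ncard
  refine ⟨S, Sᶜ, Set.union_compl_self S, disjoint_compl_right, ?_, fun U hU => ?_⟩
  · have h := hS ∅
    simp only [bipNeighborSet_empty, Set.ncard_empty] at h
    simpa using h
  · have h := hS (S ∪ U)
    have hcard : (S ∪ U).ncard = S.ncard + U.ncard :=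
      Set.ncard_union_eq (disjoint_compl_right.mono_right hU)
    have hN : ((bipNeighborSet Adj (S ∪ U)).ncard : ℝ) ≤
        (bipNeighborSet Adj S).ncard + (bipNeighborSet Adj U).ncard := by
      rw [bipNeighborSet_union]
      exact_mod_cast Set.ncard_union_le _ _
    simp only [hcard, Nat.cast_add, mul_add] at h
    linarith
end

section
/- There is an absolute constant K such that the following holds for all n ≥ 3, all real 0 < p < 1 with n·p ≥ K, and every positive integer r: in every graph G on n vertices there exists a multiset C of at most 2·p·n vertices such that for every nonempty vertex set S with |B_r(S)| ≥ (16/p)·|S|·log n, the ball B_r(S) contains at least |S| elements of C (counted with multiplicity). -/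
open Finset in
/-- Exponential-moment union bound: a uniformly random `C : Fin c → V` hits every `B S`, `S ∈ 𝓕`,
more than `k S` times with positive probability as soon as the sum of the bounds
`2 ^ k S * (1 - |B S| / (2 |V|)) ^ c` on the failure probabilities is less than one. -/
theorem exists_forall_le_card_filter_of_sum_lt_one {V ι : Type*} [Fintype V] [Nonempty V]
    [DecidableEq V] (𝓕 : Finset ι) (k : ι → ℕ) (B : ι → Finset V) (c : ℕ)
    (h : ∑ S ∈ 𝓕, (2 : ℝ) ^ k S * (1 - #(B S) / (2 * Fintype.card V)) ^ c < 1) :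
    ∃ C : Fin c → V, ∀ S ∈ 𝓕, k S ≤ #{i | C i ∈ B S} := by
  have hn : (0 : ℝ) < Fintype.card V := by exact_mod_cast Fintype.card_pos
  let w : ι → V → ℝ := fun S v ↦ if v ∈ B S then 1 / 2 else 1
  have hw : ∀ S, ∑ v, w S v = Fintype.card V * (1 - #(B S) / (2 * Fintype.card V)) := by
    intro S
    have h1 : ∀ v, w S v = 1 - if v ∈ B S then 1 / 2 else 0 := by
      intro v
      simp only [w]
      split_ifs <;> norm_num
    simp only [h1, sum_sub_distrib, sum_ite_mem, univ_inter, sum_const, card_univ, nsmul_eq_mul]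
    field_simp
  have hprod : ∀ S (C : Fin c → V), ∏ i, w S (C i) = (1 / 2 : ℝ) ^ #{i | C i ∈ B S} := by
    intro S C
    simp only [w, prod_ite, prod_const, one_pow, mul_one]
  have htotal : ∑ C : Fin c → V, ∑ S ∈ 𝓕, (2 : ℝ) ^ k S * (1 / 2) ^ #{i | C i ∈ B S}
      < ∑ _C : Fin c → V, 1 := by
    calc ∑ C : Fin c → V, ∑ S ∈ 𝓕, (2 : ℝ) ^ k S * (1 / 2) ^ #{i | C i ∈ B S}
        = (Fintype.card V : ℝ) ^ c *
            ∑ S ∈ 𝓕, (2 : ℝ) ^ k S * (1 - #(B S) / (2 * Fintype.card V)) ^ c := by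
          rw [sum_comm, mul_sum]
          refine sum_congr rfl fun S _ ↦ ?_
          rw [← mul_sum]
          simp only [← hprod]
          rw [← Fintype.sum_pow, hw, mul_pow]
          ring
      _ < (Fintype.card V : ℝ) ^ c * 1 := by gcongr
      _ = _ := by simp
  obtain ⟨C, -, hC⟩ := exists_lt_of_sum_lt htotal
  refine ⟨C, fun S hS ↦ ?_⟩
  have h1 : (2 : ℝ) ^ k S * (1 / 2) ^ #{i | C i ∈ B S} < 1 :=
    (single_le_sum (f := fun S ↦ (2 : ℝ) ^ k S * (1 / 2) ^ #{i | C i ∈ B S})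
      (fun _ _ ↦ by positivity) hS).trans_lt hC
  rw [one_div, inv_pow, ← div_eq_mul_inv, div_lt_one (by positivity)] at h1
  exact ((pow_lt_pow_iff_right₀ (by norm_num : (1 : ℝ) < 2)).1 h1).le

/-- The chance that a random cop misses is small enough to beat the number of sets of size `s`. -/
theorem two_pow_mul_pow_le_inv_sq_pow {n s c b : ℕ} {p : ℝ} (hn : 3 ≤ n) (hp : 0 < p)
    (hc : p * n ≤ c) (hbn : b ≤ n) (hb : 16 / p * s * Real.log n ≤ b) :
    (2 : ℝ) ^ s * (1 - b / (2 * n)) ^ c ≤ (((n : ℝ) ^ 2)⁻¹) ^ s := by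
  have hn' : (3 : ℝ) ≤ n := by exact_mod_cast hn
  have hn0 : (0 : ℝ) < n := by linarith
  have hbn' : (b : ℝ) ≤ n := by exact_mod_cast hbn
  have hbase : (0 : ℝ) ≤ 1 - b / (2 * n) := by
    rw [sub_nonneg, div_le_one (by positivity)]
    linarith
  have hexponent : 8 * s * Real.log n ≤ c * (b / (2 * n)) := by
    calc 8 * s * Real.log n = p * n * (16 / p * s * Real.log n / (2 * n)) := by
          field_simp
          ring
      _ ≤ c * (b / (2 * n)) := by gcongr
  have hmiss : (1 - b / (2 * n) : ℝ) ^ c ≤ (((n : ℝ) ^ 8)⁻¹) ^ s := by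
    calc (1 - b / (2 * n) : ℝ) ^ c ≤ Real.exp (-(b / (2 * n))) ^ c := by
          gcongr
          exact Real.one_sub_le_exp_neg _
      _ = Real.exp (-(c * (b / (2 * n)))) := by
          rw [← Real.exp_nat_mul]
          ring_nf
      _ ≤ Real.exp (-(8 * s * Real.log n)) := by gcongr
      _ = (((n : ℝ) ^ 8)⁻¹) ^ s := by
          rw [Real.exp_neg, show 8 * s * Real.log n = ((8 * s : ℕ) : ℝ) * Real.log n by push_cast; rfl,
            Real.exp_nat_mul, Real.exp_log hn0, pow_mul, inv_pow]
  calc (2 : ℝ) ^ s * (1 - b / (2 * n)) ^ c ≤ 2 ^ s * (((n : ℝ) ^ 8)⁻¹) ^ s := by gcongr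
    _ = (2 * ((n : ℝ) ^ 8)⁻¹) ^ s := (mul_pow _ _ _).symm
    _ ≤ (((n : ℝ) ^ 2)⁻¹) ^ s := by
        gcongr
        rw [← div_eq_mul_inv, div_le_iff₀ (by positivity), show (n : ℝ) ^ 8 = n ^ 2 * n ^ 6 by ring,
          inv_mul_cancel_left₀ (by positivity)]
        exact (by norm_num : (2 : ℝ) ≤ 3 ^ 6).trans (by gcongr)

open Finset in
theorem sum_nonempty_inv_sq_pow_card_lt_one {V : Type*} [Fintype V] [DecidableEq V]
    (hV : 3 ≤ Fintype.card V) :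
    ∑ S : Finset V with S.Nonempty, (((Fintype.card V : ℝ) ^ 2)⁻¹) ^ #S < 1 := by
  set n := Fintype.card V with hn
  have hn' : (3 : ℝ) ≤ n := by exact_mod_cast hV
  have hall : ∑ S : Finset V, (((n : ℝ) ^ 2)⁻¹) ^ #S = (((n : ℝ) ^ 2)⁻¹ + 1) ^ n := by
    rw [hn, ← card_univ (α := V), ← sum_pow_mul_eq_add_pow, powerset_univ]
    simp
  have hsplit := sum_filter_add_sum_filter_not univ (fun S : Finset V ↦ S.Nonempty)
    (fun S ↦ (((n : ℝ) ^ 2)⁻¹) ^ #S)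
  have hempty : (univ.filter fun S : Finset V ↦ ¬ S.Nonempty) = {∅} := by
    ext S
    simp
  rw [hall, hempty, sum_singleton, card_empty, pow_zero] at hsplit
  have hexp : (((n : ℝ) ^ 2)⁻¹ + 1) ^ n < 2 := by
    calc (((n : ℝ) ^ 2)⁻¹ + 1) ^ n ≤ Real.exp (((n : ℝ) ^ 2)⁻¹) ^ n := by
          gcongr
          exact Real.add_one_le_exp _
      _ = Real.exp ((n : ℝ)⁻¹) := by
          rw [← Real.exp_nat_mul]
          congr 1
          field_simp
      _ < Real.exp (Real.log 2) := by
          gcongr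
          calc (n : ℝ)⁻¹ ≤ 3⁻¹ := by gcongr
            _ < Real.log 2 := by linarith [Real.log_two_gt_d9]
      _ = 2 := Real.exp_log (by norm_num)
  linarith

/-- The ball of radius `r` around a vertex set `S`: all vertices joined to
some vertex of `S` by a walk of length at most `r`. -/
def graphBall {V : Type*} (G : SimpleGraph V) (r : ℕ) (S : Set V) : Set V :=
  {v | ∃ u ∈ S, ∃ w : G.Walk u v, w.length ≤ r}
/-- Lemma 8: there is an absolute constant `K` such that for all `n ≥ 3`, all
`0 < p < 1` with `np ≥ K` and every positive integer `r`, in every graph `G`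
on `n` vertices one can distribute at most `2pn` cops (a multiset of
vertices, here a function `Fin c → V`) so that every nonempty vertex set `S`
with `|B_r(S)| ≥ (16/p)|S| log n` has at least `|S|` cops in `B_r(S)`,
counted with multiplicity. -/
theorem sprinkle_cops :
    ∃ K : ℝ, 0 < K ∧ ∀ n : ℕ, 3 ≤ n → ∀ p : ℝ, 0 < p → p < 1 → K ≤ n * p →
      ∀ r : ℕ, 0 < r →
        ∀ (V : Type) [Fintype V], Fintype.card V = n →
          ∀ G : SimpleGraph V,
            ∃ (c : ℕ) (C : Fin c → V), (c : ℝ) ≤ 2 * p * n ∧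
              ∀ S : Set V, S.Nonempty →
                16 / p * S.ncard * Real.log n ≤ ((graphBall G r S).ncard : ℝ) →
                  S.ncard ≤ {i : Fin c | C i ∈ graphBall G r S}.ncard := by
  classical
  refine ⟨1, one_pos, fun n hn p hp _ hK r _ V _ hV G ↦ ?_⟩
  subst hV
  have : Nonempty V := Fintype.card_pos_iff.1 (by omega)
  set c := ⌊2 * p * Fintype.card V⌋₊ with hcdef
  have hc : p * Fintype.card V ≤ c := by
    have := Nat.lt_floor_add_one (2 * p * Fintype.card V)
    rw [← hcdef] at this
    linarith
  let B : Finset V → Finset V := fun S ↦ (graphBall G r S).toFinset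
  have hB : ∀ S : Finset V, (graphBall G r S).ncard = (B S).card := fun S ↦
    Set.ncard_eq_toFinset_card' _
  let 𝓕 : Finset (Finset V) := {S | S.Nonempty ∧
    16 / p * S.card * Real.log (Fintype.card V) ≤ (B S).card}
  obtain ⟨C, hC⟩ := exists_forall_le_card_filter_of_sum_lt_one 𝓕 Finset.card B c <| by
    calc ∑ S ∈ 𝓕, (2 : ℝ) ^ S.card * (1 - (B S).card / (2 * Fintype.card V)) ^ c
        ≤ ∑ S ∈ 𝓕, (((Fintype.card V : ℝ) ^ 2)⁻¹) ^ S.card :=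
          Finset.sum_le_sum fun S hS ↦ two_pow_mul_pow_le_inv_sq_pow hn hp hc
            (Finset.card_le_univ _) (Finset.mem_filter.1 hS).2.2
      _ ≤ ∑ S : Finset V with S.Nonempty, (((Fintype.card V : ℝ) ^ 2)⁻¹) ^ S.card :=
          Finset.sum_le_sum_of_subset_of_nonneg
            (Finset.monotone_filter_right _ fun _ _ h ↦ h.1) fun _ _ _ ↦ by positivity
      _ < 1 := sum_nonempty_inv_sq_pow_card_lt_one hn
  refine ⟨c, C, Nat.floor_le (by positivity), fun S hS hball ↦ ?_⟩
  lift S to Finset V using S.toFinite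
  rw [hB, Set.ncard_coe_finset] at hball
  rw [Set.ncard_coe_finset, Set.ncard_eq_toFinset_card']
  simpa [B] using hC S (Finset.mem_filter.2 ⟨Finset.mem_univ _, by simpa using hS, hball⟩)
end

section
/- Let G be a connected graph on n vertices and let 0 < p < 1. Then there exists an induced subgraph G' of G on m ≤ n vertices which is connected, has maximum degree at most 1/p, is a p-expander, and satisfies c(G) ≤ p·n + c(G'). -/
/-- `CopsWin G c C r`: with cops at positions `C`, the robber at `r`, and the
cops to move, the `c` cops can force a capture. -/
inductive CopsWin {V : Type*} (G : SimpleGraph V) (c : ℕ) : (Fin c → V) → V → Prop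
  | catch (C C' : Fin c → V) (r : V) (hm : CopMove G C C') (i : Fin c)
      (hi : C' i = r) : CopsWin G c C r
  | step (C C' : Fin c → V) (r : V) (hm : CopMove G C C')
      (h : ∀ r', (r' = r ∨ G.Adj r r') → CopsWin G c C' r') : CopsWin G c C r

/-- The cop number of a graph: the least number of cops having a winning
strategy. -/
noncomputable def copNumber {V : Type*} (G : SimpleGraph V) : ℕ :=
  sInf {c : ℕ | ∃ C₀ : Fin c → V, ∀ r : V, CopsWin G c C₀ r}


/-- A graph on a vertex type `W` is a `p`-expander if every vertex set `S` of
size at most half the number of vertices satisfies `|∂S| ≥ p|S|`. -/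
def SimpleGraph.IsExpander {W : Type*} (G : SimpleGraph W) (p : ℝ) : Prop :=
  ∀ S : Set W, (S.ncard : ℝ) ≤ Nat.card W / 2 →
    p * S.ncard ≤ ((boundary G S).ncard : ℝ)

/-- The cops indexed by `A` guard `U`: each boundary vertex of `U` lies in the closed neighbourhood
of one of them. -/
def Guards {V : Type*} (G : SimpleGraph V) {c : ℕ} (C : Fin c → V) (A : Finset (Fin c))
    (U : Set V) : Prop :=
  ∀ v ∈ boundary G U, ∃ i ∈ A, v = C i ∨ G.Adj (C i) v

/-- The properties required of the set `U` spanning the reduced subgraph. -/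
def IsNice {V : Type*} (G : SimpleGraph V) (p : ℝ) (U : Set V) : Prop :=
  (G.induce U).Connected ∧
    (∀ v : U, (((G.induce U).neighborSet v).ncard : ℝ) ≤ 1 / p) ∧ (G.induce U).IsExpander p

section Game

variable {V : Type*} {G : SimpleGraph V} {c : ℕ}

theorem CopsWin.of_dominates {C : Fin c → V} {r : V} {i : Fin c}
    (h : r = C i ∨ G.Adj (C i) r) : CopsWin G c C r := by
  classical
  refine .catch C (Function.update C i r) r (fun j => ?_) i (by simp)
  by_cases hj : j = i
  · subst hj
    simpa using h.imp id id
  · simp [hj]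

theorem Guards.congr {C T : Fin c → V} {A : Finset (Fin c)} {U : Set V} (hg : Guards G C A U)
    (h : ∀ i ∈ A, T i = C i) : Guards G T A U := by
  intro v hv
  obtain ⟨i, hi, hd⟩ := hg v hv
  exact ⟨i, hi, by rwa [h i hi]⟩

theorem Guards.mono {C : Fin c → V} {A A' : Finset (Fin c)} {U U' : Set V}
    (hg : Guards G C A U) (hA : A ⊆ A')
    (h : ∀ v ∈ U, v ∈ boundary G U' → ∃ i ∈ A', v = C i ∨ G.Adj (C i) v) (hU : U' ⊆ U) :
    Guards G C A' U' := by
  intro v hv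
  by_cases hvU : v ∈ U
  · exact h v hvU hv
  · obtain ⟨i, hi, hd⟩ := hg v ⟨hvU, hv.2.imp fun u hu => ⟨hU hu.1, hu.2⟩⟩
    exact ⟨i, hA hi, hd⟩

/-- While the guards stay put, the robber may be assumed to stay in the guarded set. -/
theorem CopsWin.step_of_guards {C C' : Fin c → V} {A : Finset (Fin c)} {U : Set V} {r : V}
    (hg : Guards G C' A U) (hm : CopMove G C C') (hr : r ∈ U)
    (h : ∀ r' ∈ U, r' = r ∨ G.Adj r r' → CopsWin G c C' r') : CopsWin G c C r := by
  refine .step C C' r hm fun r' hr' => ?_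
  by_cases hU : r' ∈ U
  · exact h r' hU hr'
  · have hadj : G.Adj r r' := hr'.resolve_left (by rintro rfl; exact hU hr)
    obtain ⟨i, -, hi⟩ := hg r' ⟨hU, r, hr, hadj⟩
    exact .of_dominates hi

/-- In a connected graph the cops can regroup while the guards stay put. -/
theorem CopsWin.of_regroup (hconn : G.Connected) {C T : Fin c → V} {A : Finset (Fin c)}
    {U : Set V} (hg : Guards G T A U) (hT : ∀ i ∈ A, C i = T i)
    (h : ∀ r ∈ U, CopsWin G c T r) : ∀ r ∈ U, CopsWin G c C r := by
  suffices H : ∀ (d : ℕ) (C : Fin c → V), (∀ i ∈ A, C i = T i) →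
      (∀ i, ∃ w : G.Walk (C i) (T i), w.length ≤ d) → ∀ r ∈ U, CopsWin G c C r by
    refine H (∑ i, G.dist (C i) (T i)) C hT fun i => ?_
    obtain ⟨w, hw⟩ := hconn.exists_walk_length_eq_dist (C i) (T i)
    exact ⟨w, hw ▸ Finset.single_le_sum (f := fun i => G.dist (C i) (T i))
      (fun _ _ => Nat.zero_le _) (Finset.mem_univ i)⟩
  intro d
  induction d with
  | zero =>
    intro C _ hw r hr
    have hCT : C = T := funext fun i => by
      obtain ⟨w, hw⟩ := hw i
      exact SimpleGraph.Walk.eq_of_length_eq_zero (Nat.le_zero.1 hw)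
    exact hCT ▸ h r hr
  | succ d ih =>
    intro C hC hw r hr
    have key : ∀ i, ∃ v, (v = C i ∨ G.Adj (C i) v) ∧ (i ∈ A → v = C i) ∧
        ∃ w : G.Walk v (T i), w.length ≤ d := by
      intro i
      by_cases hi : C i = T i
      · exact ⟨C i, .inl rfl, fun _ => rfl, hi ▸ .nil, by
          generalize C i = a at hi
          subst hi
          simp⟩
      · obtain ⟨w, hw⟩ := hw i
        revert hw
        generalize hx : C i = x at *
        cases w with
        | nil => exact absurd rfl hi
        | cons ha w =>
          intro hw
          exact ⟨_, .inr ha, fun hA => absurd (hx ▸ hC i hA) hi, w, by simpa using hw⟩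
    choose C' hm hA hw' using key
    have hC' : ∀ i ∈ A, C' i = T i := fun i hi => (hA i hi).trans (hC i hi)
    exact .step_of_guards (hg.congr hC') hm hr fun r' hr' _ => ih C' hC' hw' r' hr'

/-- Further guards can be posted on the vertices of `B`. -/
theorem CopsWin.of_post_guards (hconn : G.Connected) {C : Fin c → V} {A : Finset (Fin c)}
    {U : Set V} (hg : Guards G C A U) (B : Finset V) (hc : A.card + B.card ≤ c)
    (h : ∀ (T : Fin c → V) (A' : Finset (Fin c)), A ⊆ A' → A'.card = A.card + B.card →
      Guards G T A U → (∀ b ∈ B, ∃ i ∈ A', T i = b) → ∀ r ∈ U, CopsWin G c T r) :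
    ∀ r ∈ U, CopsWin G c C r := by
  classical
  obtain ⟨D, hDA, hDB⟩ := Finset.exists_subset_card_eq
    (show B.card ≤ Aᶜ.card by rw [Finset.card_compl, Fintype.card_fin]; omega)
  let e : D ≃ B := Finset.equivOfCardEq hDB
  let T : Fin c → V := fun i => if hi : i ∈ D then e ⟨i, hi⟩ else C i
  have hdisj : Disjoint A D :=
    Finset.disjoint_left.2 fun i hi hD => Finset.mem_compl.1 (hDA hD) hi
  have hT : ∀ i ∈ A, T i = C i := fun i hi => dif_neg (Finset.disjoint_left.1 hdisj hi)
  refine .of_regroup hconn (hg.congr hT) (fun i hi => (hT i hi).symm) ?_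
  refine h T (A ∪ D) Finset.subset_union_left ?_ (hg.congr hT) fun b hb => ?_
  · rw [Finset.card_union_of_disjoint hdisj, hDB]
  · refine ⟨e.symm ⟨b, hb⟩, Finset.mem_union_right _ (e.symm ⟨b, hb⟩).2, ?_⟩
    simp [T]

/-- A winning strategy on a guarded induced subgraph wins on the whole graph. -/
theorem CopsWin.of_induce {U : Set V} {k : ℕ} (e : Fin k ↪ Fin c) {A : Finset (Fin c)}
    (hA : ∀ j, e j ∉ A) {C₀ : Fin k → U} {r : U} (hwin : CopsWin (G.induce U) k C₀ r) :
    ∀ C : Fin c → V, Guards G C A U → (∀ j, C (e j) = C₀ j) → CopsWin G c C r := by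
  classical
  have extend : ∀ (C : Fin c → V) (C₀ C₀' : Fin k → U), (∀ j, C (e j) = C₀ j) →
      CopMove (G.induce U) C₀ C₀' → ∃ C' : Fin c → V, CopMove G C C' ∧
        (∀ j, C' (e j) = C₀' j) ∧ ∀ i ∈ A, C' i = C i := by
    intro C C₀ C₀' hC hm
    refine ⟨Function.extend e (fun j => (C₀' j : V)) C, fun i => ?_, fun j =>
      e.injective.extend_apply _ _ _, fun i hi => Function.extend_apply' _ _ _ ?_⟩
    · by_cases hi : ∃ j, e j = i
      · obtain ⟨j, rfl⟩ := hi
        rw [e.injective.extend_apply, hC]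
        exact (hm j).imp (congrArg Subtype.val) id
      · exact .inl (Function.extend_apply' _ _ _ hi)
    · rintro ⟨j, rfl⟩
      exact hA j hi
  induction hwin
  next C₀ C₀' r hm j hj =>
    intro C hg hC
    obtain ⟨C', hm', hC', -⟩ := extend C C₀ C₀' hC hm
    exact .catch C C' r hm' (e j) (by rw [hC', hj])
  next C₀ C₀' r hm _ ih =>
    intro C hg hC
    obtain ⟨C', hm', hC', hA'⟩ := extend C C₀ C₀' hC hm
    refine .step_of_guards (hg.congr hA') hm' r.2 fun r' hr' hadj => ?_
    exact ih ⟨r', hr'⟩ (hadj.imp Subtype.ext id) C' (hg.congr hA') hC'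

theorem exists_copsWin_copNumber [Finite V] :
    ∃ C₀ : Fin (copNumber G) → V, ∀ r, CopsWin G (copNumber G) C₀ r := by
  have hne : {c : ℕ | ∃ C₀ : Fin c → V, ∀ r : V, CopsWin G c C₀ r}.Nonempty :=
    ⟨Nat.card V, (Finite.equivFin V).symm, fun r =>
      .of_dominates (i := Finite.equivFin V r) (by simp)⟩
  exact Nat.sInf_mem hne

theorem CopsWin.of_copNumber_induce [Finite V] (hconn : G.Connected) {C : Fin c → V}
    {A : Finset (Fin c)} {U : Set V} (hg : Guards G C A U)
    (hc : A.card + copNumber (G.induce U) ≤ c) : ∀ r ∈ U, CopsWin G c C r := by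
  classical
  obtain ⟨C₀, hwin⟩ := exists_copsWin_copNumber (G := G.induce U)
  obtain ⟨e⟩ : Nonempty (Fin (copNumber (G.induce U)) ↪ {i // i ∉ A}) := by
    refine Function.Embedding.nonempty_of_card_le ?_
    rw [Fintype.card_fin, Fintype.card_subtype_compl, Fintype.card_fin, Fintype.card_coe]
    omega
  let f := e.trans (Function.Embedding.subtype _)
  have hf : ∀ j, f j ∉ A := fun j => (e j).2
  let T := Function.extend f (fun j => (C₀ j : V)) C
  have hT : ∀ i ∈ A, T i = C i := by
    refine fun i hi => Function.extend_apply' _ _ _ ?_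
    rintro ⟨j, rfl⟩
    exact hf j hi
  refine .of_regroup hconn (hg.congr hT) (fun i hi => (hT i hi).symm) fun r hr => ?_
  exact .of_induce f hf (hwin ⟨r, hr⟩) T (hg.congr hT) fun j => f.injective.extend_apply _ _ _

end Game

theorem SimpleGraph.IsExpander.connected {W : Type*} [Finite W] [Nonempty W] {H : SimpleGraph W}
    {p : ℝ} (hp : 0 < p) (h : H.IsExpander p) : H.Connected := by
  have small : ∀ S : Set W, boundary H S = ∅ → (S.ncard : ℝ) ≤ Nat.card W / 2 → S = ∅ := by
    intro S hS hcard
    have := h S hcard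
    rw [hS, Set.ncard_empty, Nat.cast_zero] at this
    have h0 : (S.ncard : ℝ) ≤ 0 := by nlinarith
    exact (Set.ncard_eq_zero).1 (Nat.le_zero.1 (by exact_mod_cast h0))
  rw [SimpleGraph.connected_iff_exists_forall_reachable]
  obtain ⟨v⟩ := ‹Nonempty W›
  refine ⟨v, fun w => ?_⟩
  let S := {w | H.Reachable v w}
  have hb : boundary H S = ∅ := Set.eq_empty_of_forall_notMem fun x ⟨hx, u, hu, hadj⟩ =>
    hx (hu.trans hadj.reachable)
  have hb' : boundary H Sᶜ = ∅ := Set.eq_empty_of_forall_notMem fun x ⟨hx, u, hu, hadj⟩ =>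
    hu ((not_not.1 hx : H.Reachable v x).trans hadj.symm.reachable)
  have hsum : (S.ncard : ℝ) + Sᶜ.ncard = Nat.card W := by
    exact_mod_cast Set.ncard_add_ncard_compl S
  rcases le_total (S.ncard : ℝ) (Nat.card W / 2) with hS | hS
  · have : v ∈ S := SimpleGraph.Reachable.refl v
    simp [small S hb hS] at this
  · by_contra hw
    have : w ∈ Sᶜ := hw
    simp [small Sᶜ hb' (by linarith)] at this

theorem isNice_singleton {V : Type*} (G : SimpleGraph V) {p : ℝ} (hp : 0 < p) (v : V) :
    IsNice G p {v} := by
  have hexp : (G.induce {v}).IsExpander p := by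
    intro S hS
    rw [Nat.card_unique, Nat.cast_one] at hS
    have : S.ncard = 0 := by
      have : (S.ncard : ℝ) < 1 := by linarith
      exact Nat.lt_one_iff.1 (by exact_mod_cast this)
    simp [this]
  exact ⟨hexp.connected hp, fun w => by simp [hp.le], hexp⟩

/-- With `p * |V \ U|` guards around `U`, the cops win once they are enough to win on every nice
induced subgraph after spending `p * |V|` guards. -/
theorem CopsWin.of_guards_card_le {V : Type*} [Finite V] {G : SimpleGraph V}
    (hconn : G.Connected) {p : ℝ} (hp : 0 < p) {c : ℕ}
    (hc : ⌊p * Nat.card V⌋₊ ≤ c)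
    (hnice : ∀ U, IsNice G p U → ⌊p * Nat.card V⌋₊ + copNumber (G.induce U) ≤ c)
    (U : Set V) (C : Fin c → V) (A : Finset (Fin c)) (hg : Guards G C A U)
    (hA : (A.card : ℝ) ≤ p * (Nat.card V - U.ncard)) : ∀ r ∈ U, CopsWin G c C r := by
  classical
  induction hU : U.ncard using Nat.strong_induction_on generalizing U C A with
  | _ k ih =>
  subst hU
  have le_floor : ∀ (a : ℕ) (W : Set V), (a : ℝ) ≤ p * (Nat.card V - W.ncard) →
      a ≤ ⌊p * Nat.card V⌋₊ := fun a W h => Nat.le_floor (by nlinarith [W.ncard.cast_nonneg (α := ℝ)])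
  intro r₀ hr₀
  by_cases hdeg : ∀ v : U, (((G.induce U).neighborSet v).ncard : ℝ) ≤ 1 / p
  swap
  · push Not at hdeg
    obtain ⟨v, hv⟩ := hdeg
    let S : Set V := Subtype.val '' ((G.induce U).neighborSet v)
    have hScard : S.ncard = ((G.induce U).neighborSet v).ncard :=
      Set.ncard_image_of_injective _ Subtype.val_injective
    have hSU : S ⊆ U := by rintro _ ⟨x, -, rfl⟩; exact x.2
    have hadjS : ∀ x ∈ S, G.Adj v x := by rintro _ ⟨x, hx, rfl⟩; exact hx
    let U' : Set V := (U \ S) \ {v.1}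
    have hcardS : (U \ S).ncard + S.ncard = U.ncard := Set.ncard_sdiff_add_ncard_of_subset hSU
    have hlt : U'.ncard < U.ncard := Set.ncard_lt_ncard
      ⟨fun x hx => hx.1.1, fun h => (h v.2).2 rfl⟩
    have hle : U'.ncard ≤ (U \ S).ncard := Set.ncard_le_ncard Set.sdiff_subset
    have hle' : (U'.ncard : ℝ) + S.ncard ≤ U.ncard := by
      exact_mod_cast (by omega : U'.ncard + S.ncard ≤ U.ncard)
    have h1 : 1 < p * S.ncard := by
      rw [hScard]
      rwa [div_lt_iff₀' hp] at hv
    have hA' : ((A.card + 1 : ℕ) : ℝ) ≤ p * (Nat.card V - U'.ncard) := by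
      push_cast
      nlinarith
    refine CopsWin.of_post_guards hconn hg {v.1} ?_ ?_ r₀ hr₀
    · exact (le_floor _ _ hA').trans hc
    · intro T A' hAA' hcard hgT hB r hr
      obtain ⟨i, hi, hiv⟩ := hB v (Finset.mem_singleton_self _)
      by_cases hd : r = T i ∨ G.Adj (T i) r
      · exact .of_dominates hd
      · rw [hiv] at hd
        push Not at hd
        refine ih _ hlt U' T A' (hgT.mono hAA' ?_ fun x hx => hx.1.1) ?_ rfl r
          ⟨⟨hr, fun h => hd.2 (hadjS r h)⟩, hd.1⟩
        · intro x hx hxb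
          refine ⟨i, hi, ?_⟩
          rw [hiv]
          by_contra! hxd
          exact hxb.1 ⟨⟨hx, fun h => hxd.2 (hadjS x h)⟩, hxd.1⟩
        · rwa [hcard, Finset.card_singleton]
  by_cases hexp : (G.induce U).IsExpander p
  · have : Nonempty U := ⟨⟨r₀, hr₀⟩⟩
    have := hnice U ⟨hexp.connected hp, hdeg, hexp⟩
    exact .of_copNumber_induce hconn hg (by have := le_floor _ _ hA; omega) r₀ hr₀
  · simp only [SimpleGraph.IsExpander] at hexp
    push Not at hexp
    obtain ⟨S₀, hhalf, hlt⟩ := hexp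
    set S : Set V := Subtype.val '' S₀ with hS
    set B : Set V := Subtype.val '' boundary (G.induce U) S₀ with hB
    rw [Nat.card_coe_set_eq, ← Set.ncard_image_of_injective S₀ Subtype.val_injective,
      ← hS] at hhalf
    rw [← Set.ncard_image_of_injective S₀ Subtype.val_injective,
      ← Set.ncard_image_of_injective (boundary _ S₀) Subtype.val_injective, ← hS, ← hB] at hlt
    have hSU : S ⊆ U := by rintro _ ⟨x, -, rfl⟩; exact x.2
    have hmemB : ∀ x ∈ U, x ∉ S → ∀ u ∈ S, G.Adj u x → x ∈ B := by
      rintro x hx hxS _ ⟨u, hu, rfl⟩ hadj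
      exact ⟨⟨x, hx⟩, ⟨fun h => hxS ⟨_, h, rfl⟩, u, hu, hadj⟩, rfl⟩
    have hcardS : (U \ S).ncard + S.ncard = U.ncard := Set.ncard_sdiff_add_ncard_of_subset hSU
    have hcardS' : ((U \ S).ncard : ℝ) + S.ncard = U.ncard := by exact_mod_cast hcardS
    have hpos : (0 : ℝ) < S.ncard := by
      by_contra! h0
      have := B.ncard.cast_nonneg (α := ℝ)
      nlinarith
    have hpos' : 0 < S.ncard := by exact_mod_cast hpos
    have hltS : S.ncard < U.ncard := by
      have : (S.ncard : ℝ) < U.ncard := by linarith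
      exact_mod_cast this
    let U' : Set V := (U \ S) \ B
    have hle : U'.ncard ≤ (U \ S).ncard := Set.ncard_le_ncard Set.sdiff_subset
    have hle' : (U'.ncard : ℝ) ≤ (U \ S).ncard := by exact_mod_cast hle
    have hBfin := B.toFinite
    have hBcard : hBfin.toFinset.card = B.ncard := (Set.ncard_eq_toFinset_card B hBfin).symm
    have hA₁ : ((A.card + B.ncard : ℕ) : ℝ) ≤ p * (Nat.card V - S.ncard) := by
      push_cast
      nlinarith
    have hA₂ : ((A.card + B.ncard : ℕ) : ℝ) ≤ p * (Nat.card V - U'.ncard) := by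
      push_cast
      nlinarith
    refine CopsWin.of_post_guards hconn hg hBfin.toFinset ?_ ?_ r₀ hr₀
    · rw [hBcard]
      exact (le_floor _ _ hA₁).trans hc
    · intro T A' hAA' hcard hgT hB' r hr
      rw [hBcard] at hcard
      have hB'' : ∀ b ∈ B, ∃ i ∈ A', b = T i ∨ G.Adj (T i) b := fun b hb =>
        (hB' b (hBfin.mem_toFinset.2 hb)).imp fun i hi => ⟨hi.1, .inl hi.2.symm⟩
      by_cases hrB : r ∈ B
      · obtain ⟨i, -, hi⟩ := hB'' r hrB
        exact .of_dominates hi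
      by_cases hrS : r ∈ S
      · refine ih _ hltS S T A' (hgT.mono hAA' ?_ hSU) (by rwa [hcard]) rfl r hrS
        rintro x hx ⟨hxS, u, hu, hadj⟩
        exact hB'' x (hmemB x hx hxS u hu hadj)
      · refine ih _ (by omega) U' T A' (hgT.mono hAA' ?_ fun x hx => hx.1.1) (by rwa [hcard]) rfl r
          ⟨⟨hr, hrS⟩, hrB⟩
        rintro x hx ⟨hxU', u, hu, hadj⟩
        refine hB'' x ?_
        by_contra hxB
        have hxS : x ∈ S := by
          by_contra hxS
          exact hxU' ⟨⟨hx, hxS⟩, hxB⟩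
        exact hu.2 (hmemB u hu.1.1 hu.1.2 x hxS hadj.symm)

/-- Corollary 10: for every connected graph `G` on `n` vertices and every
`0 < p < 1` there is an induced subgraph `G'` on `m ≤ n` vertices which is
connected, has maximum degree at most `1/p`, is a `p`-expander, and satisfies
`c(G) ≤ pn + c(G')`. -/
theorem copNumber_nice_reduction {V : Type} [Fintype V] (G : SimpleGraph V)
    (n : ℕ) (hn : Fintype.card V = n) (hconn : G.Connected)
    (p : ℝ) (hp0 : 0 < p) (hp1 : p < 1) :
    ∃ U : Set V, U.ncard ≤ n ∧
      (G.induce U).Connected ∧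
      (∀ v : U, (((G.induce U).neighborSet v).ncard : ℝ) ≤ 1 / p) ∧
      (G.induce U).IsExpander p ∧
      (copNumber G : ℝ) ≤ p * n + copNumber (G.induce U) := by
  obtain ⟨v⟩ := hconn.nonempty
  have : Nonempty {U // IsNice G p U} := ⟨⟨{v}, isNice_singleton G hp0 v⟩⟩
  obtain ⟨⟨U, hU⟩, hmax⟩ :=
    Finite.exists_max fun U : {U // IsNice G p U} => copNumber (G.induce U.1)
  refine ⟨U, ?_, hU.1, hU.2.1, hU.2.2, ?_⟩
  · rw [← hn, ← Nat.card_eq_fintype_card]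
    exact Set.ncard_le_card U
  have hcop : copNumber G ≤ ⌊p * n⌋₊ + copNumber (G.induce U) := by
    refine Nat.sInf_le ⟨fun _ => v, fun r => ?_⟩
    have hn' : Nat.card V = n := by rw [Nat.card_eq_fintype_card, hn]
    refine CopsWin.of_guards_card_le hconn hp0 ?_ ?_ Set.univ _ ∅ ?_ ?_ r (Set.mem_univ r)
    · rw [hn']
      exact Nat.le_add_right _ _
    · intro W hW
      rw [hn']
      exact Nat.add_le_add_left (hmax ⟨W, hW⟩) _
    · exact fun w hw => absurd (Set.mem_univ w) hw.1
    · simp [Set.ncard_univ]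
  have hfloor : (⌊p * n⌋₊ : ℝ) ≤ p * n := Nat.floor_le (by positivity)
  calc (copNumber G : ℝ) ≤ (⌊p * n⌋₊ + copNumber (G.induce U) : ℕ) := by exact_mod_cast hcop
    _ ≤ p * n + copNumber (G.induce U) := by
      push_cast
      linarith
end

section
/- There exists a function p : ℕ → (0,1) with log₂(1/p(n)) / √(log₂ n) → 1 as n → ∞ (i.e., p(n) = 2^{-(1-o(1))√(log₂ n)}) such that for every ε > 0 and all sufficiently large n the following holds: every connected graph G on m ≤ n vertices whose maximum degree is less than 1/p(n) and which is a p(n)-expander has cop number c(G) ≤ (1+ε)·√(log₂ n)·2·p(n)·n. -/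
section ExpanderCops

open Finset Filter

section Game

variable {V : Type*} {G : SimpleGraph V}

/-- The positions a robber starting at `v` can occupy after `s` rounds without having been caught
by cops that follow the fixed schedule `P`. -/
def robberRange (G : SimpleGraph V) {c : ℕ} (P : ℕ → Fin c → V) (v : V) : ℕ → Set V
  | 0 => {v}
  | s + 1 => {w | ∃ u ∈ robberRange G P v s, (∀ i, P (s + 1) i ≠ u) ∧ (w = u ∨ G.Adj u w)}

theorem copsWin_of_robberRange_eq_empty {c : ℕ} {P : ℕ → Fin c → V}
    (hP : ∀ s, CopMove G (P s) (P (s + 1))) {v : V} {T : ℕ} (hT : robberRange G P v T = ∅) :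
    CopsWin G c (P 0) v := by
  have key : ∀ d s, s + d = T → ∀ u ∈ robberRange G P v s, CopsWin G c (P s) u := by
    intro d
    induction d with
    | zero =>
      rintro s rfl u hu
      rw [add_zero] at hT
      simp [hT] at hu
    | succ d ih =>
      intro s hs u hu
      by_cases hc : ∃ i, P (s + 1) i = u
      · obtain ⟨i, hi⟩ := hc
        exact .catch _ _ _ (hP s) i hi
      · push Not at hc
        exact .step _ _ _ (hP s) fun r' hr' => ih (s + 1) (by omega) r' ⟨u, hu, hc, hr'⟩
  exact key T 0 (zero_add T) v rfl

theorem copNumber_le {c : ℕ} (C : Fin c → V) (h : ∀ r, CopsWin G c C r) : copNumber G ≤ c :=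
  Nat.sInf_le ⟨C, h⟩

theorem copNumber_le_card [Fintype V] : copNumber G ≤ Fintype.card V := by
  refine copNumber_le (fun i => (Fintype.equivFin V).symm i) fun r => ?_
  exact .catch _ _ r (fun _ => Or.inl rfl) (Fintype.equivFin V r) (by simp)

end Game

section Ball

variable {V : Type*} [Fintype V] {G : SimpleGraph V}

open Classical in
/-- The vertices at distance at most `r` from the set `S`. -/
noncomputable def ballFinset (G : SimpleGraph V) (r : ℕ) (S : Finset V) : Finset V :=
  {v | ∃ u ∈ S, ∃ w : G.Walk v u, w.length ≤ r}

theorem mem_ballFinset {r : ℕ} {S : Finset V} {v : V} :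
    v ∈ ballFinset G r S ↔ ∃ u ∈ S, ∃ w : G.Walk v u, w.length ≤ r := by
  simp [ballFinset]

theorem ballFinset_empty (r : ℕ) : ballFinset G r ∅ = ∅ := by
  ext v
  simp [mem_ballFinset]

theorem subset_ballFinset (r : ℕ) (S : Finset V) : S ⊆ ballFinset G r S :=
  fun v hv => mem_ballFinset.2 ⟨v, hv, .nil, by simp⟩

theorem ballFinset_union [DecidableEq V] (r : ℕ) (S T : Finset V) :
    ballFinset G r (S ∪ T) = ballFinset G r S ∪ ballFinset G r T := by
  ext v
  simp only [mem_union, mem_ballFinset]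
  grind

theorem mem_ballFinset_succ {r : ℕ} {S : Finset V} {u w : V} (hu : u ∈ ballFinset G r S)
    (hw : w = u ∨ G.Adj u w) : w ∈ ballFinset G (r + 1) S := by
  obtain ⟨a, ha, q, hq⟩ := mem_ballFinset.1 hu
  rcases hw with rfl | hw
  · exact mem_ballFinset.2 ⟨a, ha, q, by omega⟩
  · exact mem_ballFinset.2 ⟨a, ha, .cons hw.symm q, by simpa using hq⟩

theorem exists_route_of_mem_ballFinset {r : ℕ} {v a : V} (h : v ∈ ballFinset G r {a}) :
    ∃ q : ℕ → V, q 0 = v ∧ q r = a ∧ ∀ s, q (s + 1) = q s ∨ G.Adj (q s) (q (s + 1)) := by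
  obtain ⟨a', ha', w, hw⟩ := mem_ballFinset.1 h
  obtain rfl := mem_singleton.1 ha'
  refine ⟨w.getVert, w.getVert_zero, w.getVert_of_length_le hw, fun s => ?_⟩
  rcases lt_or_ge s w.length with hs | hs
  · exact .inr (w.adj_getVert_succ hs)
  · left
    rw [w.getVert_of_length_le hs, w.getVert_of_length_le (hs.trans s.le_succ)]

theorem SimpleGraph.IsExpander.pow_le_card_ballFinset {p : ℝ} (hp : 0 < p) (hG : G.IsExpander p)
    {S : Finset V} (hS : S.Nonempty) (r : ℕ) :
    (Fintype.card V : ℝ) / 2 < #(ballFinset G r S) ∨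
      (1 + p) ^ r ≤ (#(ballFinset G r S) : ℝ) := by
  classical
  induction r with
  | zero =>
    right
    have : 0 < #(ballFinset G 0 S) := card_pos.2 (hS.mono (subset_ballFinset 0 S))
    simpa using this
  | succ r ih =>
    have hsub : ballFinset G r S ⊆ ballFinset G (r + 1) S :=
      fun v hv => mem_ballFinset_succ hv (.inl rfl)
    rcases lt_or_ge ((Fintype.card V : ℝ) / 2) #(ballFinset G r S) with h | h
    · exact .inl (h.trans_le (by exact_mod_cast card_le_card hsub))
    · right
      have hr := ih.resolve_left h.not_gt
      have hexp := hG (ballFinset G r S) (by simpa using h)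
      rw [Set.ncard_coe_finset] at hexp
      have hbd : (boundary G (ballFinset G r S)).ncard + #(ballFinset G r S) ≤
          #(ballFinset G (r + 1) S) := by
        rw [← Set.ncard_coe_finset, ← Set.ncard_coe_finset, ← Set.ncard_union_eq _
          (Set.toFinite _) (Set.toFinite _)]
        · refine Set.ncard_le_ncard (Set.union_subset ?_ (by exact_mod_cast hsub))
            (Set.toFinite _)
          rintro v ⟨-, u, hu, huv⟩
          exact mem_ballFinset_succ (mem_coe.1 hu) (.inr huv)
        · exact Set.disjoint_left.2 fun v hv => hv.1
      have hbd' : ((boundary G (ballFinset G r S)).ncard : ℝ) + #(ballFinset G r S) ≤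
          #(ballFinset G (r + 1) S) := by exact_mod_cast hbd
      calc (1 + p) ^ (r + 1) = (1 + p) * (1 + p) ^ r := by ring
        _ ≤ (1 + p) * #(ballFinset G r S) := by gcongr
        _ ≤ _ := by linarith

end Ball

/-- A uniformly random `k`-tuple of vertices meets every large set of a given family about as often
as expected: if the set `B A` has at least `K * #A` elements, then it is hit at least `#A` times. -/
theorem exists_tuple_hitting {V : Type*} [Fintype V] [DecidableEq V] [Nonempty V]
    (B : Finset V → Finset V) {k : ℕ} {K : ℝ}
    (hK : 2 * Fintype.card V * Real.log (4 * Fintype.card V) ≤ K * k) :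
    ∃ f : Fin k → V, ∀ A : Finset V, K * #A ≤ #(B A) → #A ≤ #{j | f j ∈ B A} := by
  set m : ℝ := (Fintype.card V : ℝ) with hm
  have hm0 : 0 < m := by rw [hm]; exact_mod_cast Fintype.card_pos
  by_contra! hcon
  have hchern : ∀ A : Finset V, K * #A ≤ #(B A) →
      ∑ f : Fin k → V, (2 : ℝ) ^ #A * ∏ j, (if f j ∈ B A then (1 / 2 : ℝ) else 1) ≤
        m ^ k * (1 / (2 * m)) ^ #A := by
    intro A hA
    have hsum : ∑ v, (if v ∈ B A then (1 / 2 : ℝ) else 1) = m * (1 - #(B A) / (2 * m)) := by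
      have : ∀ v, (if v ∈ B A then (1 / 2 : ℝ) else 1) =
          1 - (if v ∈ B A then (1 / 2 : ℝ) else 0) := fun v => by split_ifs <;> norm_num
      simp only [this, sum_sub_distrib, sum_ite_mem, univ_inter]
      rw [sum_const, card_univ, nsmul_eq_mul, sum_const, nsmul_eq_mul, ← hm]
      field_simp
    have hle : (#(B A) : ℝ) ≤ m := by rw [hm]; exact_mod_cast card_le_univ _
    have hfrac : (#(B A) : ℝ) / (2 * m) ≤ 1 := by
      rw [div_le_one (by positivity)]; linarith
    have hpow : (1 - #(B A) / (2 * m)) ^ k ≤ (1 / (4 * m)) ^ #A := by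
      calc (1 - #(B A) / (2 * m)) ^ k ≤ Real.exp (-(#(B A) / (2 * m))) ^ k := by
            refine pow_le_pow_left₀ (by linarith) ?_ k
            linarith [Real.add_one_le_exp (-((#(B A) : ℝ) / (2 * m)))]
        _ = Real.exp (-(k * #(B A) / (2 * m))) := by
            rw [← Real.exp_nat_mul]; congr 1; ring
        _ ≤ Real.exp (#A * -Real.log (4 * m)) := by
            refine Real.exp_le_exp.2 ?_
            have h1 : #A * Real.log (4 * m) ≤ k * #(B A) / (2 * m) := by
              rw [le_div_iff₀ (by positivity)]
              calc #A * Real.log (4 * m) * (2 * m) = #A * (2 * m * Real.log (4 * m)) := by ring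
                _ ≤ #A * (K * k) := by gcongr
                _ = k * (K * #A) := by ring
                _ ≤ k * #(B A) := by gcongr
            linarith
        _ = (1 / (4 * m)) ^ #A := by
            rw [Real.exp_nat_mul, Real.exp_neg, Real.exp_log (by positivity), one_div]
    rw [← mul_sum, ← Fintype.sum_pow (fun v => if v ∈ B A then (1 / 2 : ℝ) else 1), hsum, mul_pow]
    calc (2 : ℝ) ^ #A * (m ^ k * (1 - #(B A) / (2 * m)) ^ k)
        ≤ 2 ^ #A * (m ^ k * (1 / (4 * m)) ^ #A) := by gcongr
      _ = m ^ k * (2 * (1 / (4 * m))) ^ #A := by rw [mul_pow]; ring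
      _ = m ^ k * (1 / (2 * m)) ^ #A := by congr 2; field_simp; norm_num
  set F : Finset (Finset V) := {A | A.Nonempty ∧ K * #A ≤ #(B A)} with hF
  have hcover : ∀ f : Fin k → V,
      1 ≤ ∑ A ∈ F, (2 : ℝ) ^ #A * ∏ j, (if f j ∈ B A then (1 / 2 : ℝ) else 1) := by
    intro f
    obtain ⟨A, hA, hlt⟩ := hcon f
    have hAF : A ∈ F := by
      simp only [hF, mem_filter, mem_univ, true_and]
      exact ⟨card_pos.1 (by omega), hA⟩
    have hnn : ∀ A ∈ F, 0 ≤ (2 : ℝ) ^ #A * ∏ j, (if f j ∈ B A then (1 / 2 : ℝ) else 1) :=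
      fun A _ => mul_nonneg (by positivity)
        (prod_nonneg fun j _ => by split_ifs <;> norm_num)
    refine le_trans ?_ (single_le_sum hnn hAF)
    rw [prod_ite, prod_const, prod_const_one, mul_one, one_div, inv_pow, ← div_eq_mul_inv,
      one_le_div (by positivity)]
    exact pow_le_pow_right₀ (by norm_num) hlt.le
  have htotal : m ^ k ≤ ∑ A ∈ F, m ^ k * (1 / (2 * m)) ^ #A := by
    calc m ^ k = ∑ _f : Fin k → V, (1 : ℝ) := by simp [hm]
      _ ≤ ∑ f : Fin k → V, ∑ A ∈ F,
            (2 : ℝ) ^ #A * ∏ j, (if f j ∈ B A then (1 / 2 : ℝ) else 1) :=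
          sum_le_sum fun f _ => hcover f
      _ = ∑ A ∈ F, ∑ f : Fin k → V,
            (2 : ℝ) ^ #A * ∏ j, (if f j ∈ B A then (1 / 2 : ℝ) else 1) := sum_comm
      _ ≤ _ := sum_le_sum fun A hA => hchern A (mem_filter.1 hA).2.2
  have hsub : ∑ A ∈ F, (1 / (2 * m)) ^ #A + 1 ≤ (1 / (2 * m) + 1) ^ Fintype.card V := by
    have hall := Finset.sum_pow_mul_eq_add_pow (1 / (2 * m)) 1 (univ : Finset V)
    simp only [one_pow, mul_one, powerset_univ, card_univ] at hall
    rw [← hall]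
    have hnot : (∅ : Finset V) ∉ F := by simp [hF]
    have := sum_le_sum_of_subset_of_nonneg (subset_univ (insert ∅ F))
      (fun A _ _ => by positivity : ∀ A ∈ (univ : Finset (Finset V)), A ∉ insert ∅ F →
        0 ≤ (1 / (2 * m)) ^ #A)
    rw [sum_insert hnot] at this
    simpa [add_comm] using this
  have hexp : (1 / (2 * m) + 1) ^ Fintype.card V < 2 := by
    calc (1 / (2 * m) + 1) ^ Fintype.card V ≤ Real.exp (1 / (2 * m)) ^ Fintype.card V := by
          gcongr
          exact Real.add_one_le_exp _
      _ = Real.exp (1 / 2) := by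
          rw [← Real.exp_nat_mul, ← hm]; congr 1; field_simp
      _ < 2 := by
          rw [← Real.lt_log_iff_exp_lt (by norm_num)]
          linarith [Real.log_two_gt_d9]
  rw [← mul_sum] at htotal
  have : 1 ≤ ∑ A ∈ F, (1 / (2 * m)) ^ #A := by
    by_contra! h
    exact absurd htotal (not_le.2 (mul_lt_of_lt_one_right (by positivity) h))
  linarith

/-- Apart from a subset `D` with small `r`-ball, a vertex set `A` can be occupied within `r` moves
by cops whose positions `f` hit every large `r`-ball sufficiently often. -/
theorem exists_exceptional_subset {V : Type*} [Fintype V] {G : SimpleGraph V} {r k : ℕ} {K : ℝ}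
    {f : Fin k → V}
    (hf : ∀ A, K * #A ≤ #(ballFinset G r A) → ∃ J : Finset (Fin k), #A ≤ #J ∧
      ∀ j ∈ J, f j ∈ ballFinset G r A) (A : Finset V) :
    ∃ D ⊆ A, (#(ballFinset G r D) : ℝ) ≤ K * #D ∧ ∃ q : Fin k → ℕ → V,
      (∀ j, q j 0 = f j) ∧ (∀ j s, q j (s + 1) = q j s ∨ G.Adj (q j s) (q j (s + 1))) ∧
      ∀ a ∈ A, a ∉ D → ∃ j, q j r = a := by
  classical
  let 𝒟 : Finset (Finset V) := {D ∈ A.powerset | (#(ballFinset G r D) : ℝ) ≤ K * #D}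
  have h𝒟 : 𝒟.Nonempty := ⟨∅, by simp [𝒟, ballFinset_empty]⟩
  obtain ⟨D, hD, hmax⟩ := exists_max_image 𝒟 card h𝒟
  obtain ⟨hDA, hDK⟩ : D ⊆ A ∧ (#(ballFinset G r D) : ℝ) ≤ K * #D := by simpa [𝒟] using hD
  have hlarge : ∀ X ⊆ A \ D, K * #X ≤ #(ballFinset G r X) := by
    intro X hX
    by_contra! hlt
    have hdisj : Disjoint D X :=
      disjoint_of_subset_right hX disjoint_sdiff
    have hcard : #(D ∪ X) = #D + #X := card_union_of_disjoint hdisj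
    have hmem : D ∪ X ∈ 𝒟 := by
      refine mem_filter.2 ⟨mem_powerset.2 (union_subset hDA (hX.trans sdiff_subset)), ?_⟩
      rw [hcard, ballFinset_union]
      have : (#(ballFinset G r D ∪ ballFinset G r X) : ℝ) ≤
          #(ballFinset G r D) + #(ballFinset G r X) := by exact_mod_cast card_union_le _ _
      push_cast
      linarith
    have hX0 : #X = 0 := by
      have := hmax _ hmem
      omega
    rw [card_eq_zero] at hX0
    simp [hX0, ballFinset_empty] at hlt
  let N : (A \ D : Finset V) → Finset (Fin k) := fun a => {j | f j ∈ ballFinset G r {a.1}}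
  obtain ⟨g, hg, hgN⟩ := (all_card_le_biUnion_card_iff_exists_injective N).1 fun s => by
    obtain ⟨J, hJ, hJf⟩ := hf (s.map (.subtype _)) (hlarge _ fun a ha => by
      obtain ⟨b, -, rfl⟩ := mem_map.1 ha
      exact b.2)
    rw [card_map] at hJ
    refine hJ.trans (card_le_card fun j hj => ?_)
    obtain ⟨a, ha, w⟩ := mem_ballFinset.1 (hJf j hj)
    obtain ⟨b, hb, rfl⟩ := mem_map.1 ha
    exact mem_biUnion.2 ⟨b, hb, mem_filter.2 ⟨mem_univ _,
      mem_ballFinset.2 ⟨_, mem_singleton_self _, w⟩⟩⟩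
  have hroute : ∀ j, ∃ q : ℕ → V, q 0 = f j ∧
      (∀ s, q (s + 1) = q s ∨ G.Adj (q s) (q (s + 1))) ∧ ∀ a, g a = j → q r = a := by
    intro j
    by_cases hj : ∃ a, g a = j
    · obtain ⟨a, rfl⟩ := hj
      obtain ⟨q, h0, hr, hq⟩ := exists_route_of_mem_ballFinset (mem_filter.1 (hgN a)).2
      exact ⟨q, h0, hq, fun b hb => by rw [hr, hg hb]⟩
    · exact ⟨fun _ => f j, rfl, fun _ => .inl rfl, fun a ha => (hj ⟨a, ha⟩).elim⟩
  choose q h0 hq hr using hroute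
  exact ⟨D, hDA, hDK, q, h0, hq, fun a ha haD =>
    ⟨g ⟨a, mem_sdiff.2 ⟨ha, haD⟩⟩, hr _ _ rfl⟩⟩

/-- If all balls of radius `2 ^ t` are large, then `t + 1` groups of `k` cops win. -/
theorem copNumber_le_of_lt_card_ballFinset {V : Type*} [Fintype V] [Nonempty V]
    {G : SimpleGraph V} {t k : ℕ} {K : ℝ} (hK0 : 0 ≤ K)
    (hK : 2 * Fintype.card V * Real.log (4 * Fintype.card V) ≤ K * k)
    (hball : ∀ S : Finset V, S.Nonempty → K ^ (t + 1) < #(ballFinset G (2 ^ t) S)) :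
    copNumber G ≤ (t + 1) * k := by
  classical
  choose f hf using fun i : ℕ => exists_tuple_hitting (ballFinset G (2 ^ i)) hK
  have hex := fun i : ℕ => exists_exceptional_subset (G := G) (r := 2 ^ i) (K := K) (f := f i)
    fun A hA => ⟨_, hf i A hA, fun j hj => (mem_filter.1 hj).2⟩
  choose D hDA hDK q hq0 hq hqr using hex
  let e : Fin (t + 1) × Fin k ≃ Fin ((t + 1) * k) := finProdFinEquiv
  refine copNumber_le (fun c => f (e.symm c).1 (e.symm c).2) fun v => ?_
  obtain ⟨A, hA0, hAs⟩ : ∃ A : ℕ → Finset V, A 0 = {v} ∧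
      ∀ i, A (i + 1) = ballFinset G (2 ^ i) (D i (A i)) :=
    ⟨fun i => Nat.rec {v} (fun i A => ballFinset G (2 ^ i) (D i A)) i, rfl, fun _ => rfl⟩
  let P : ℕ → Fin ((t + 1) * k) → V := fun s c =>
    q (e.symm c).1 (A (e.symm c).1) (e.symm c).2 s
  have hP0 : P 0 = fun c => f (e.symm c).1 (e.symm c).2 := funext fun c => hq0 _ _ _
  have hP : ∀ s, CopMove G (P s) (P (s + 1)) := fun s c => hq _ _ _ s
  have hcard : ∀ i, (#(A i) : ℝ) ≤ K ^ i := by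
    intro i
    induction i with
    | zero => simp [hA0]
    | succ i ih =>
      calc (#(A (i + 1)) : ℝ) ≤ K * #(D i (A i)) := by rw [hAs]; exact hDK i (A i)
        _ ≤ K * #(A i) := by gcongr; exact hDA i (A i)
        _ ≤ K * K ^ i := by gcongr
        _ = K ^ (i + 1) := by ring
  have hlast : A (t + 1) = ∅ := by
    have hD : D t (A t) = ∅ := by
      by_contra hne
      have h1 := hball _ (nonempty_iff_ne_empty.2 hne)
      rw [← hAs] at h1
      exact absurd (hcard (t + 1)) (not_le.2 h1)
    rw [hAs, hD, ballFinset_empty]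
  have hrange : ∀ i : ℕ, i ≤ t + 1 → robberRange G P v (2 ^ i - 1) ⊆ (A i : Set V) := by
    intro i
    induction i with
    | zero => intro _; simp [hA0, robberRange]
    | succ i ih =>
      intro hi
      have hi' := ih (by omega)
      have hpos : 0 < 2 ^ i := by positivity
      have hstep : ∀ d, robberRange G P v (2 ^ i + d) ⊆
          (ballFinset G (d + 1) (D i (A i)) : Set V) := by
        intro d
        induction d with
        | zero =>
          obtain ⟨s, hs⟩ : ∃ s, 2 ^ i = s + 1 := ⟨2 ^ i - 1, by omega⟩
          rw [hs, Nat.add_sub_cancel] at hi'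
          rw [add_zero, hs]
          rintro w ⟨u, hu, hfree, hw⟩
          have huD : u ∈ D i (A i) := by
            by_contra hnot
            obtain ⟨j, hj⟩ := hqr i (A i) u (hi' hu) hnot
            refine hfree (e (⟨i, by omega⟩, j)) ?_
            simpa [P, ← hs] using hj
          exact mem_ballFinset_succ (subset_ballFinset 0 _ huD) hw
        | succ d ihd =>
          rintro w ⟨u, hu, -, hw⟩
          exact mem_ballFinset_succ (ihd hu) hw
      have := hstep (2 ^ i - 1)
      rwa [Nat.sub_add_cancel hpos, show 2 ^ i + (2 ^ i - 1) = 2 ^ (i + 1) - 1 by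
        rw [pow_succ]; omega, ← hAs] at this
  rw [← hP0]
  refine copsWin_of_robberRange_eq_empty hP (T := 2 ^ (t + 1) - 1) ?_
  have := hrange (t + 1) le_rfl
  rw [hlast] at this
  simpa using this

theorem SimpleGraph.IsExpander.copNumber_le {V : Type*} [Fintype V] [Nonempty V]
    {G : SimpleGraph V} {n : ℕ} {x p : ℝ} (hx : 3 ≤ x) (hn : (n : ℝ) = 2 ^ (x ^ 2))
    (hp : p = 2 ^ (-(x - √x))) (hlog : 2 * Real.log (4 * n) ≤ 2 ^ (√x - 3))
    (hm : Fintype.card V ≤ n) (hG : G.IsExpander p) :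
    (copNumber G : ℝ) ≤ x * (2 * p * n) := by
  have hmn : (Fintype.card V : ℝ) ≤ n := by exact_mod_cast hm
  have hm1 : (1 : ℝ) ≤ Fintype.card V := by exact_mod_cast Fintype.card_pos
  have hsqrt : √x ≤ x := Real.sqrt_le_iff.2 ⟨by linarith, by nlinarith⟩
  have hp0 : 0 < p := by rw [hp]; positivity
  have hp1 : p ≤ 1 := by
    rw [hp]
    exact Real.rpow_le_one_of_one_le_of_nonpos one_le_two (by linarith)
  have hpn : p * n = 2 ^ (x ^ 2 - x + √x) := by
    rw [hp, hn, ← Real.rpow_add two_pos]; congr 1; ring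
  have hpn1 : 1 ≤ p * n := by
    rw [hpn]
    exact Real.one_le_rpow one_le_two (by nlinarith [Real.sqrt_nonneg x])
  rcases le_or_gt (Fintype.card V : ℝ) (x * (2 * p * n)) with hsmall | hlarge
  · exact le_trans (by exact_mod_cast copNumber_le_card) hsmall
  have hhalf : p * n < Fintype.card V / 2 := by nlinarith
  have hfloor : 3 ≤ ⌊x⌋₊ := Nat.le_floor (by exact_mod_cast hx)
  obtain ⟨t, ht⟩ : ∃ t, ⌊x⌋₊ = t + 2 := ⟨⌊x⌋₊ - 2, by omega⟩
  have ht1 : (t : ℝ) + 1 ≤ x - 1 := by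
    have := Nat.floor_le (show 0 ≤ x by linarith)
    rw [ht] at this
    push_cast at this
    linarith
  have ht2 : x - 3 ≤ t := by
    have := Nat.lt_floor_add_one x
    rw [ht] at this
    push_cast at this
    linarith
  have hk := Nat.le_ceil (p * n)
  have hcop : copNumber G ≤ (t + 1) * ⌈p * n⌉₊ := by
    refine copNumber_le_of_lt_card_ballFinset (K := 2 ^ (x - 1)) (by positivity) ?_ ?_
    · have h4 : Real.log (4 * Fintype.card V) ≤ Real.log (4 * n) := by gcongr
      have h4' : 0 ≤ Real.log (4 * Fintype.card V) := Real.log_nonneg (by linarith)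
      calc 2 * Fintype.card V * Real.log (4 * Fintype.card V)
          ≤ 2 * n * Real.log (4 * n) := by gcongr
        _ = n * (2 * Real.log (4 * n)) := by ring
        _ ≤ n * 2 ^ (√x - 3) := by gcongr
        _ ≤ n * 2 ^ (√x - 1) := by gcongr <;> norm_num
        _ = 2 ^ (x - 1) * (p * n) := by
            rw [hp, ← mul_assoc, ← Real.rpow_add two_pos, mul_comm]
            congr 2; ring
        _ ≤ _ := by gcongr
    · intro S hS
      have hpow : ((2 : ℝ) ^ (x - 1)) ^ (t + 1) ≤ p * n := by
        rw [← Real.rpow_mul_natCast two_pos.le, hpn]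
        refine Real.rpow_le_rpow_of_exponent_le one_le_two ?_
        push_cast
        nlinarith [Real.sqrt_nonneg x]
      refine hpow.trans_lt (hhalf.trans_le ?_)
      rcases hG.pow_le_card_ballFinset hp0 hS (2 ^ t) with h | h
      · exact h.le
      · refine le_trans ?_ h
        have hl : p / 2 ≤ Real.log (1 + p) := by
          refine le_trans ?_ (Real.le_log_one_add_of_nonneg hp0.le)
          rw [div_le_div_iff₀ two_pos (by linarith)]
          nlinarith
        have hcard : Real.log (Fintype.card V) ≤ Real.log ((1 + p) ^ 2 ^ t) := by
          calc Real.log (Fintype.card V) ≤ Real.log (4 * n) :=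
                Real.log_le_log (by linarith) (by linarith)
            _ ≤ 2 ^ (√x - 3) / 2 := by linarith
            _ = 2 ^ (x - 3) * (p / 2) := by
                rw [hp, ← mul_div_assoc, ← Real.rpow_add two_pos]
                congr 2; ring
            _ ≤ 2 ^ (t : ℝ) * Real.log (1 + p) := by gcongr; norm_num
            _ = Real.log ((1 + p) ^ 2 ^ t) := by
                rw [Real.log_pow, Real.rpow_natCast]; push_cast; rfl
        have := (Real.log_le_log_iff (by linarith) (by positivity)).1 hcard
        linarith
  have hceil : (⌈p * n⌉₊ : ℝ) ≤ 2 * p * n := by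
    linarith [(Nat.ceil_lt_add_one (zero_le_one.trans hpn1)).le]
  calc (copNumber G : ℝ) ≤ (t + 1) * ⌈p * n⌉₊ := by exact_mod_cast hcop
    _ ≤ x * (2 * p * n) := by gcongr; linarith

theorem tendsto_sqrt_logb_natCast :
    Tendsto (fun n : ℕ => √(Real.logb 2 n)) atTop atTop :=
  Real.tendsto_sqrt_atTop.comp
    ((Real.tendsto_logb_atTop one_lt_two).comp tendsto_natCast_atTop_atTop)

theorem eventually_two_mul_log_le :
    ∀ᶠ n : ℕ in atTop, 2 * Real.log (4 * n) ≤ 2 ^ (√√(Real.logb 2 n) - 3) := by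
  have hz := Real.tendsto_sqrt_atTop.comp tendsto_sqrt_logb_natCast
  have hpow := (isLittleO_pow_exp_pos_mul_atTop (k := 5) (Real.log_pos one_lt_two)).bound
    zero_lt_one
  filter_upwards [hz.eventually hpow, hz.eventually_ge_atTop 32, eventually_ge_atTop 1]
    with n h5 h32 hn
  simp only [Function.comp_apply] at h5 h32
  have hn1 : (1 : ℝ) ≤ n := by exact_mod_cast hn
  have hL : 0 ≤ Real.logb 2 n := Real.logb_nonneg one_lt_two hn1
  set z := √√(Real.logb 2 n) with hzdef
  have hz4 : z ^ 4 = Real.logb 2 n := by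
    rw [show 4 = 2 * 2 from rfl, pow_mul, hzdef, Real.sq_sqrt (Real.sqrt_nonneg _),
      Real.sq_sqrt hL]
  have hlog : Real.log (4 * n) ≤ z ^ 4 + 2 := by
    have h4 : Real.log (4 * n) = Real.log 2 * (z ^ 4 + 2) := by
      have hlog4 : Real.log 4 = 2 * Real.log 2 := by
        rw [show (4 : ℝ) = 2 ^ 2 by norm_num, Real.log_pow]; norm_num
      rw [Real.log_mul (by norm_num) (by positivity), hz4, Real.logb, hlog4]
      field_simp
      ring
    rw [h4]
    exact mul_le_of_le_one_left (by positivity) (by linarith [Real.log_two_lt_d9])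
  have h5' : z ^ 5 ≤ 2 ^ z := by
    rw [Real.norm_of_nonneg (by positivity), Real.norm_of_nonneg (by positivity), one_mul] at h5
    rwa [Real.rpow_def_of_pos two_pos]
  have h45 : 16 * (z ^ 4 + 2) ≤ z ^ 5 := by
    have : (2 : ℝ) ≤ z ^ 4 := by nlinarith [one_le_pow₀ (n := 3) (show 1 ≤ z by linarith)]
    nlinarith
  rw [Real.rpow_sub two_pos, le_div_iff₀ (by positivity)]
  norm_num
  linarith

end ExpanderCops

/-- Lemma 11: there is a function `p = p(n) = 2^{-(1-o(1))√(log₂ n)}` (i.e.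
with `log₂(1/p(n))/√(log₂ n) → 1`) such that for every `ε > 0` and all
sufficiently large `n`, every connected graph on `m ≤ n` vertices with
maximum degree less than `1/p(n)` which is a `p(n)`-expander has cop number
at most `(1+ε)·√(log₂ n)·2·p(n)·n`. -/
theorem copNumber_expander_bound :
    ∃ p : ℕ → ℝ, (∀ n, 0 < p n ∧ p n < 1) ∧
      Filter.Tendsto (fun n : ℕ => Real.logb 2 (1 / p n) / Real.sqrt (Real.logb 2 n))
        Filter.atTop (nhds 1) ∧
      ∀ ε : ℝ, 0 < ε → ∃ N : ℕ, ∀ n : ℕ, N ≤ n →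
        ∀ (V : Type) [Fintype V], ∀ m : ℕ, Fintype.card V = m → m ≤ n →
          ∀ G : SimpleGraph V, G.Connected →
            (∀ v : V, ((G.neighborSet v).ncard : ℝ) < 1 / p n) →
            G.IsExpander (p n) →
            (copNumber G : ℝ) ≤ (1 + ε) * Real.sqrt (Real.logb 2 n) * (2 * p n * n) := by
  have hx := tendsto_sqrt_logb_natCast
  refine ⟨fun n => if 1 < √(Real.logb 2 n) then
    2 ^ (-(√(Real.logb 2 n) - √√(Real.logb 2 n))) else 1 / 2, fun n => ?_, ?_, ?_⟩
  · beta_reduce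
    split_ifs with h
    · have : √√(Real.logb 2 n) < √(Real.logb 2 n) := 
        (Real.sqrt_lt' (by linarith)).2 (by nlinarith)
      exact ⟨by positivity, Real.rpow_lt_one_of_one_lt_of_neg one_lt_two (by linarith)⟩
    · norm_num
  · have hlim : Filter.Tendsto (fun n : ℕ => 1 - (√√(Real.logb 2 n))⁻¹) Filter.atTop (nhds 1) := by
      simpa using (tendsto_inv_atTop_zero.comp
        (Real.tendsto_sqrt_atTop.comp hx)).const_sub 1
    refine hlim.congr' ?_
    filter_upwards [hx.eventually_gt_atTop 1] with n hn
    rw [if_pos hn, one_div, ← Real.rpow_neg two_pos.le, neg_neg,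
      Real.logb_rpow two_pos (by norm_num), sub_div, div_self (by linarith),
      Real.sqrt_div_self]
  · intro ε hε
    obtain ⟨N, hN⟩ := Filter.eventually_atTop.1
      ((hx.eventually_ge_atTop 3).and
        (eventually_two_mul_log_le.and (Filter.eventually_ge_atTop 1)))
    refine ⟨N, fun n hn V _ m hm hmn G hconn _ hG => ?_⟩
    obtain ⟨h3, hlog, h1⟩ := hN n hn
    have hn1 : (1 : ℝ) ≤ n := by exact_mod_cast h1
    have hif : 1 < √(Real.logb 2 n) := by linarith
    have := hconn.nonempty
    simp only [if_pos hif] at hG ⊢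
    have hpow : (n : ℝ) = 2 ^ (√(Real.logb 2 n) ^ 2) := by
      rw [Real.sq_sqrt (Real.logb_nonneg one_lt_two hn1),
        Real.rpow_logb two_pos (by norm_num) (by positivity)]
    refine (hG.copNumber_le h3 hpow rfl hlog (hm.trans_le hmn)).trans ?_
    gcongr
    exact le_mul_of_one_le_left (by positivity) (by linarith)
end
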